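/- arXiv:1303.4575 — 2 statements merged into one kernel-verified Lean document; each statement's English description precedes it below -/
import Mathlib

section
/- Let (γ, ℓ, ℓ⁽²⁾, Y) be coordinate hypersurface data on U with inverse blocks (P, n, n⁽²⁾) and derived fields Γ̄^c_{ab}, K_{ab}, φ_a, Ψ^b_a, and let u : U → ℝ∖{0}, V = (V^a) : U → ℝ^m be smooth gauge fields. Let (γ', ℓ', ℓ⁽²⁾', Y') be the gauge-transformed data and let Γ̄'^c_{ab}, K'_{ab}, φ'_a, Ψ'^b_a be its derived fields. Then: (a) the primed block matrix 𝔸' = [[γ', ℓ'],[ℓ'ᵀ, ℓ⁽²⁾']] is invertible with inverse blocks P'^{ab} = P^{ab} + n⁽²⁾V^aV^b − V^an^b − V^bn^a, n'^a = u⁻¹(n^a − n⁽²⁾V^a), n⁽²⁾' = u⁻²n⁽²⁾; (b) Γ̄'^c_{ab} = Γ̄^c_{ab} + V^cK_{ab}; (c) K'_{ab} = u⁻¹K_{ab}; (d) φ'_a = φ_a + u⁻¹∂_au − K_{ab}V^b; (e) Ψ'^b_a = u(Ψ^b_a + ∇̄_aV^b − φ_aV^b + K_{ad}V^dV^b). 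-/
open scoped BigOperators

noncomputable section

namespace HypData

variable {m : ℕ}

/-- Scalar field on ℝ^m. -/
abbrev Sc (m : ℕ) := (Fin m → ℝ) → ℝ
/-- One-index field. -/
abbrev Vec (m : ℕ) := (Fin m → ℝ) → Fin m → ℝ
/-- Two-index field. -/
abbrev Ten (m : ℕ) := (Fin m → ℝ) → Fin m → Fin m → ℝ
/-- Connection coefficients `Γ x c a b = Γ^c_{ab}` (first index upper). -/
abbrev Conn (m : ℕ) := (Fin m → ℝ) → Fin m → Fin m → Fin m → ℝ
/-- Three-index field. -/
abbrev Ten3 (m : ℕ) := (Fin m → ℝ) → Fin m → Fin m → Fin m → ℝ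

/-- Partial derivative of `f` in the `a`-th coordinate direction at `x`. -/
def pd (a : Fin m) (f : Sc m) (x : Fin m → ℝ) : ℝ :=
  fderiv ℝ f x (Pi.single a 1)

/-- Kronecker delta. -/
def kd (a b : Fin m) : ℝ := if a = b then 1 else 0

/-- Equations (EqP1)-(EqP4): `[[P,n],[nᵀ,n2]]` consists of the inverse blocks of
the block matrix `[[γ,ℓ],[ℓᵀ,ℓ2]]`. -/
def InvBlocks (γ : Fin m → Fin m → ℝ) (ℓ : Fin m → ℝ) (ℓ2 : ℝ)
    (P : Fin m → Fin m → ℝ) (n : Fin m → ℝ) (n2 : ℝ) : Prop :=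
  (∀ a b, (∑ c, P a c * γ c b) + n a * ℓ b = kd a b) ∧
  (∀ a, (∑ b, P a b * ℓ b) + ℓ2 * n a = 0) ∧
  ((∑ a, n a * ℓ a) + n2 * ℓ2 = 1) ∧
  (∀ a, (∑ b, γ a b * n b) + n2 * ℓ a = 0)

/-- ∇_a ω_b. -/
def covD1 (Γ : Conn m) (ω : Vec m) (x : Fin m → ℝ) (a b : Fin m) : ℝ :=
  pd a (fun y => ω y b) x - ∑ d, Γ x d a b * ω x d

/-- ∇_a X^b. -/
def covD1U (Γ : Conn m) (X : Vec m) (x : Fin m → ℝ) (a b : Fin m) : ℝ :=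
  pd a (fun y => X y b) x + ∑ d, Γ x b a d * X x d

/-- ∇_a T_{bc}. -/
def covD2 (Γ : Conn m) (T : Ten m) (x : Fin m → ℝ) (a b c : Fin m) : ℝ :=
  pd a (fun y => T y b c) x - (∑ d, Γ x d a b * T x d c) - (∑ d, Γ x d a c * T x b d)

/-- ∇_a T^{bc}. -/
def covD2U (Γ : Conn m) (T : Ten m) (x : Fin m → ℝ) (a b c : Fin m) : ℝ :=
  pd a (fun y => T y b c) x + (∑ d, Γ x b a d * T x d c) + (∑ d, Γ x c a d * T x b d)

/-- ∇_a S^b_c (first index of `S` upper, second lower). -/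
def covD11 (Γ : Conn m) (S : Ten m) (x : Fin m → ℝ) (a b c : Fin m) : ℝ :=
  pd a (fun y => S y b c) x + (∑ d, Γ x b a d * S x d c) - (∑ d, Γ x d a c * S x b d)

/-- ∇_a Q^{bcd}. -/
def covD3U (Γ : Conn m) (Q : Ten3 m) (x : Fin m → ℝ) (a b c d : Fin m) : ℝ :=
  pd a (fun y => Q y b c d) x + (∑ f, Γ x b a f * Q x f c d)
    + (∑ f, Γ x c a f * Q x b f d) + (∑ f, Γ x d a f * Q x b c f)

/-- Curvature `R^a_{bcd} = ∂_cΓ^a_{db} − ∂_dΓ^a_{cb} + Γ^a_{cf}Γ^f_{db} − Γ^a_{df}Γ^f_{cb}`. -/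
def curv (Γ : Conn m) (x : Fin m → ℝ) (a b c d : Fin m) : ℝ :=
  pd c (fun y => Γ y a d b) x - pd d (fun y => Γ y a c b) x
    + (∑ f, Γ x a c f * Γ x f d b) - (∑ f, Γ x a d f * Γ x f c b)

/-- `F_{ab} = ½(∂_aℓ_b − ∂_bℓ_a)`. -/
def Ff (ℓ : Vec m) (x : Fin m → ℝ) (a b : Fin m) : ℝ :=
  (pd a (fun y => ℓ y b) x - pd b (fun y => ℓ y a) x) / 2

/-- `U_{ab} = ½(n^c∂_cγ_{ab} + γ_{cb}∂_an^c + γ_{ac}∂_bn^c + ℓ_a∂_bn⁽²⁾ + ℓ_b∂_an⁽²⁾)`. -/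
def Uf (γ : Ten m) (ℓ : Vec m) (n : Vec m) (n2 : Sc m)
    (x : Fin m → ℝ) (a b : Fin m) : ℝ :=
  ((∑ c, (n x c * pd c (fun y => γ y a b) x + γ x c b * pd a (fun y => n y c) x
      + γ x a c * pd b (fun y => n y c) x))
    + ℓ x a * pd b n2 x + ℓ x b * pd a n2 x) / 2

/-- Metric hypersurface connection `Γ̊^c_{ab}`. -/
def Gam0 (γ : Ten m) (ℓ : Vec m) (P : Ten m) (n : Vec m)
    (x : Fin m → ℝ) (c a b : Fin m) : ℝ :=
  (∑ d, P x c d * (pd a (fun y => γ y b d) x + pd b (fun y => γ y a d) x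
      - pd d (fun y => γ y a b) x)) / 2
  + n x c * (pd a (fun y => ℓ y b) x + pd b (fun y => ℓ y a) x) / 2

/-- The connection `Γ̄^c_{ab} = Γ̊^c_{ab} − n^c Y_{ab}`. -/
def GamB (γ : Ten m) (ℓ : Vec m) (P : Ten m) (n : Vec m) (Y : Ten m)
    (x : Fin m → ℝ) (c a b : Fin m) : ℝ :=
  Gam0 γ ℓ P n x c a b - n x c * Y x a b

/-- `K_{ab} = n⁽²⁾Y_{ab} + U_{ab}`. -/
def Kf (γ : Ten m) (ℓ : Vec m) (n : Vec m) (n2 : Sc m) (Y : Ten m)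
    (x : Fin m → ℝ) (a b : Fin m) : ℝ :=
  n2 x * Y x a b + Uf γ ℓ n n2 x a b

/-- `φ_a = ½n⁽²⁾∂_aℓ⁽²⁾ + n^b(Y_{ab} + F_{ab})`. -/
def phif (ℓ : Vec m) (ℓ2 : Sc m) (n : Vec m) (n2 : Sc m) (Y : Ten m)
    (x : Fin m → ℝ) (a : Fin m) : ℝ :=
  n2 x * pd a ℓ2 x / 2 + ∑ b, n x b * (Y x a b + Ff ℓ x a b)

/-- `Ψ^b_a = P^{bc}(Y_{ac} + F_{ac}) + ½n^b∂_aℓ⁽²⁾`. -/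
def Psif (ℓ : Vec m) (ℓ2 : Sc m) (P : Ten m) (n : Vec m) (Y : Ten m)
    (x : Fin m → ℝ) (b a : Fin m) : ℝ :=
  (∑ c, P x b c * (Y x a c + Ff ℓ x a c)) + n x b * pd a ℓ2 x / 2

/-- Smoothness of a scalar field on `U`. -/
def SmSc (U : Set (Fin m → ℝ)) (f : Sc m) : Prop := ContDiffOn ℝ (⊤ : ℕ∞) f U
/-- Smoothness of a one-index field on `U`. -/
def SmVec (U : Set (Fin m → ℝ)) (f : Vec m) : Prop :=
  ∀ a, ContDiffOn ℝ (⊤ : ℕ∞) (fun x => f x a) U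
/-- Smoothness of a two-index field on `U`. -/
def SmTen (U : Set (Fin m → ℝ)) (f : Ten m) : Prop :=
  ∀ a b, ContDiffOn ℝ (⊤ : ℕ∞) (fun x => f x a b) U

/-- Smooth coordinate hypersurface metric data on `U`. -/
def MetricData (U : Set (Fin m → ℝ)) (γ : Ten m) (ℓ : Vec m) (ℓ2 : Sc m)
    (P : Ten m) (n : Vec m) (n2 : Sc m) : Prop :=
  SmTen U γ ∧ SmVec U ℓ ∧ SmSc U ℓ2 ∧ SmTen U P ∧ SmVec U n ∧ SmSc U n2 ∧
  (∀ x ∈ U, ∀ a b, γ x a b = γ x b a) ∧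
  (∀ x ∈ U, ∀ a b, P x a b = P x b a) ∧
  (∀ x ∈ U, InvBlocks (γ x) (ℓ x) (ℓ2 x) (P x) (n x) (n2 x))

/-- Gauge-transformed `ℓ`. -/
def gaugeL (γ : Ten m) (ℓ : Vec m) (u : Sc m) (V : Vec m) : Vec m :=
  fun x a => u x * (ℓ x a + ∑ b, V x b * γ x a b)

/-- Gauge-transformed `ℓ⁽²⁾`. -/
def gaugeL2 (γ : Ten m) (ℓ : Vec m) (ℓ2 : Sc m) (u : Sc m) (V : Vec m) : Sc m :=
  fun x => u x ^ 2 * (ℓ2 x + 2 * (∑ a, V x a * ℓ x a) + ∑ a, ∑ b, V x a * V x b * γ x a b)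

/-- Gauge-transformed `Y`. -/
def gaugeY (γ : Ten m) (ℓ : Vec m) (Y : Ten m) (u : Sc m) (V : Vec m) : Ten m :=
  fun x a b => u x * Y x a b + (ℓ x a * pd b u x + ℓ x b * pd a u x) / 2
    + ((u x * ∑ c, V x c * pd c (fun y => γ y a b) x)
      + (∑ c, γ x c b * pd a (fun y => u y * V y c) x)
      + (∑ c, γ x a c * pd b (fun y => u y * V y c) x)) / 2

/-- Gauge-transformed `P`. -/
def gaugeP (P : Ten m) (n : Vec m) (n2 : Sc m) (V : Vec m) : Ten m :=
  fun x a b => P x a b + n2 x * V x a * V x b - V x a * n x b - V x b * n x a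

/-- Gauge-transformed `n`. -/
def gaugeN (n : Vec m) (n2 : Sc m) (u : Sc m) (V : Vec m) : Vec m :=
  fun x a => (u x)⁻¹ * (n x a - n2 x * V x a)

/-- Gauge-transformed `n⁽²⁾`. -/
def gaugeN2 (n2 : Sc m) (u : Sc m) : Sc m :=
  fun x => ((u x) ^ 2)⁻¹ * n2 x

/-- Shell energy-momentum tensor `τ^{fa}` built pointwise from the jump `V_{ab}`. -/
def tauP (P : Fin m → Fin m → ℝ) (n : Fin m → ℝ) (n2 : ℝ) (V : Fin m → Fin m → ℝ)
    (f a : Fin m) : ℝ :=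
  (∑ c, ∑ d, (n f * P a c + n a * P f c) * n d * V c d)
  - (∑ c, ∑ d, (n2 * P f c * P a d + P f a * n c * n d) * V c d)
  + (n2 * P f a - n f * n a) * (∑ c, ∑ d, P c d * V c d)

/-- `τ^f_c = −(n⁽²⁾P^{bd} − n^bn^d)(δ^f_dV_{bc} − δ^f_cV_{bd})`. -/
def tauMixP (P : Fin m → Fin m → ℝ) (n : Fin m → ℝ) (n2 : ℝ)
    (V : Fin m → Fin m → ℝ) (f c : Fin m) : ℝ :=
  -(∑ b, ∑ d, (n2 * P b d - n b * n d) * (kd f d * V b c - kd f c * V b d))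

/-- `T^f = (P^{bf}n^c − P^{bc}n^f)V_{bc}`. -/
def tauVecP (P : Fin m → Fin m → ℝ) (n : Fin m → ℝ) (V : Fin m → Fin m → ℝ)
    (f : Fin m) : ℝ :=
  ∑ b, ∑ c, (P b f * n c - P b c * n f) * V b c

/-- The block matrix 𝔸. -/
def blockA (γ : Ten m) (ℓ : Vec m) (ℓ2 : Sc m) (x : Fin m → ℝ) :
    Matrix (Fin m ⊕ Unit) (Fin m ⊕ Unit) ℝ :=
  fun i j =>
    match i, j with
    | Sum.inl a, Sum.inl b => γ x a b
    | Sum.inl a, Sum.inr _ => ℓ x a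
    | Sum.inr _, Sum.inl b => ℓ x b
    | Sum.inr _, Sum.inr _ => ℓ2 x

/-- `det 𝔸` as a scalar field. -/
def detA (γ : Ten m) (ℓ : Vec m) (ℓ2 : Sc m) (x : Fin m → ℝ) : ℝ :=
  (blockA γ ℓ ℓ2 x).det

end HypData

namespace HypData

section PartialDerivatives

variable {m : ℕ} {f g : Sc m} {x : Fin m → ℝ}

theorem pd_congr (h : f =ᶠ[nhds x] g) (a : Fin m) : pd a f x = pd a g x := by
  rw [pd, pd, h.fderiv_eq]

theorem pd_add (hf : DifferentiableAt ℝ f x) (hg : DifferentiableAt ℝ g x) (a : Fin m) :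
    pd a (fun y => f y + g y) x = pd a f x + pd a g x := by
  simp only [pd]
  rw [fderiv_fun_add hf hg]
  rfl

theorem pd_mul (hf : DifferentiableAt ℝ f x) (hg : DifferentiableAt ℝ g x) (a : Fin m) :
    pd a (fun y => f y * g y) x = pd a f x * g x + f x * pd a g x := by
  simp only [pd]
  rw [fderiv_fun_mul hf hg]
  simp only [add_apply, smul_apply, smul_eq_mul]
  ring

theorem pd_const (r : ℝ) (a : Fin m) : pd a (fun _ => r) x = 0 := by
  simp [pd]

theorem pd_sum {h : Fin m → Sc m} (hh : ∀ c, DifferentiableAt ℝ (h c) x) (a : Fin m) :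
    pd a (fun y => ∑ c, h c y) x = ∑ c, pd a (h c) x := by
  simp only [pd]
  rw [fderiv_fun_sum fun c _ => hh c]
  simp

theorem pd_sum_mul {h k : Fin m → Sc m} (hh : ∀ c, DifferentiableAt ℝ (h c) x)
    (hk : ∀ c, DifferentiableAt ℝ (k c) x) (a : Fin m) :
    pd a (fun y => ∑ c, h c y * k c y) x
      = (∑ c, pd a (h c) x * k c x) + ∑ c, h c x * pd a (k c) x := by
  rw [pd_sum (h := fun c y => h c y * k c y) fun c => (hh c).mul (hk c),
    ← Finset.sum_add_distrib]
  exact Finset.sum_congr rfl fun c _ => pd_mul (hh c) (hk c) a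

end PartialDerivatives

section Contractions

variable {m : ℕ}

theorem sum_mul_sum_swap (f v : Fin m → ℝ) (M : Fin m → Fin m → ℝ) :
    ∑ b, f b * ∑ c, v c * M b c = ∑ c, v c * ∑ b, f b * M b c := by
  simp only [Finset.mul_sum]
  rw [Finset.sum_comm]
  exact Finset.sum_congr rfl fun c _ => Finset.sum_congr rfl fun b _ => by ring

theorem sum_mul_kd (v : Fin m → ℝ) (a : Fin m) : ∑ c, v c * kd a c = v a := by
  simp [kd]

theorem sum_gaugeP_mul (P : Ten m) (n : Vec m) (n2 : Sc m) (V : Vec m) (x : Fin m → ℝ)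
    (b : Fin m) (w : Fin m → ℝ) :
    ∑ c, gaugeP P n n2 V x b c * w c
      = (∑ c, P x b c * w c) + n2 x * V x b * (∑ c, V x c * w c)
        - V x b * (∑ c, n x c * w c) - n x b * ∑ c, V x c * w c := by
  simp only [gaugeP, Finset.mul_sum, ← Finset.sum_add_distrib, ← Finset.sum_sub_distrib]
  exact Finset.sum_congr rfl fun c _ => by ring

theorem sum_gaugeN_mul (n : Vec m) (n2 u : Sc m) (V : Vec m) (x : Fin m → ℝ)
    (w : Fin m → ℝ) :
    ∑ c, gaugeN n n2 u V x c * w c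
      = (u x)⁻¹ * ((∑ c, n x c * w c) - n2 x * ∑ c, V x c * w c) := by
  simp only [gaugeN, Finset.mul_sum, ← Finset.sum_sub_distrib]
  exact Finset.sum_congr rfl fun c _ => by ring

theorem sum_mul_gaugeL (γ : Ten m) (ℓ : Vec m) (u : Sc m) (V : Vec m) (x : Fin m → ℝ)
    (f : Fin m → ℝ) :
    ∑ c, f c * gaugeL γ ℓ u V x c
      = u x * ((∑ c, f c * ℓ x c) + ∑ c, f c * ∑ d, V x d * γ x c d) := by
  simp only [gaugeL, Finset.mul_sum (s := Finset.univ) (a := u x),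
    ← Finset.sum_add_distrib]
  exact Finset.sum_congr rfl fun c _ => by ring

theorem gaugeL2_eq (γ : Ten m) (ℓ : Vec m) (ℓ2 u : Sc m) (V : Vec m) (x : Fin m → ℝ) :
    gaugeL2 γ ℓ ℓ2 u V x
      = u x ^ 2 * (ℓ2 x + 2 * (∑ c, V x c * ℓ x c)
          + ∑ c, V x c * ∑ d, V x d * γ x c d) := by
  simp only [gaugeL2, Finset.mul_sum, mul_assoc]

end Contractions

namespace InvBlocks

variable {m : ℕ} {γ : Fin m → Fin m → ℝ} {ℓ : Fin m → ℝ} {ℓ2 : ℝ}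
  {P : Fin m → Fin m → ℝ} {n : Fin m → ℝ} {n2 : ℝ}

theorem sum_n_mul_γ (h : InvBlocks γ ℓ ℓ2 P n n2) (hγ : ∀ a b, γ a b = γ b a) (b : Fin m) :
    ∑ c, n c * γ c b = -(n2 * ℓ b) := by
  rw [← add_eq_zero_iff_eq_neg, ← h.2.2.2 b]
  congr 1
  exact Finset.sum_congr rfl fun c _ => by rw [hγ c b, mul_comm]

theorem sum_n_mul_lower (h : InvBlocks γ ℓ ℓ2 P n n2) (hγ : ∀ a b, γ a b = γ b a)
    (v : Fin m → ℝ) :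
    ∑ b, n b * ∑ c, v c * γ b c = -(n2 * ∑ c, v c * ℓ c) := by
  rw [sum_mul_sum_swap, Finset.mul_sum, ← Finset.sum_neg_distrib]
  exact Finset.sum_congr rfl fun c _ => by rw [h.sum_n_mul_γ hγ]; ring

theorem sum_P_mul_lower (h : InvBlocks γ ℓ ℓ2 P n n2) (v : Fin m → ℝ) (a : Fin m) :
    ∑ b, P a b * ∑ c, v c * γ b c = v a - n a * ∑ c, v c * ℓ c := by
  rw [sum_mul_sum_swap, ← sum_mul_kd v a, Finset.mul_sum, ← Finset.sum_sub_distrib]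
  exact Finset.sum_congr rfl fun c _ => by rw [← h.1 a c]; ring

end InvBlocks

theorem invBlocks_gauge {m : ℕ} {γ : Ten m} {ℓ : Vec m} {ℓ2 : Sc m} {P : Ten m} {n : Vec m}
    {n2 u : Sc m} (V : Vec m) {x : Fin m → ℝ} (hγ : ∀ a b, γ x a b = γ x b a)
    (h : InvBlocks (γ x) (ℓ x) (ℓ2 x) (P x) (n x) (n2 x)) (hu : u x ≠ 0) :
    InvBlocks (γ x) (gaugeL γ ℓ u V x) (gaugeL2 γ ℓ ℓ2 u V x)
      (gaugeP P n n2 V x) (gaugeN n n2 u V x) (gaugeN2 n2 u x) := by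
  have hn := h.sum_n_mul_lower hγ (V x)
  refine ⟨fun a b => ?_, fun a => ?_, ?_, fun a => ?_⟩
  · have hV : ∑ c, V x c * γ x c b = ∑ c, V x c * γ x b c :=
      Finset.sum_congr rfl fun c _ => by rw [hγ c b]
    rw [sum_gaugeP_mul, h.sum_n_mul_γ hγ, hV, ← h.1 a b]
    simp only [gaugeN, gaugeL]
    field_simp
    ring
  · rw [sum_gaugeP_mul]
    simp only [sum_mul_gaugeL]
    rw [gaugeL2_eq, hn, h.sum_P_mul_lower]
    simp only [gaugeN]
    field_simp
    linear_combination u x * h.2.1 a - u x * V x a * h.2.2.1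
  · rw [sum_gaugeN_mul]
    simp only [sum_mul_gaugeL]
    rw [gaugeL2_eq, hn]
    simp only [gaugeN2]
    field_simp
    linear_combination h.2.2.1
  · have hc : ∑ b, γ x a b * gaugeN n n2 u V x b
        = ∑ b, gaugeN n n2 u V x b * γ x b a :=
      Finset.sum_congr rfl fun b _ => by rw [hγ a b, mul_comm]
    have hV : ∑ c, V x c * γ x c a = ∑ c, V x c * γ x a c :=
      Finset.sum_congr rfl fun c _ => by rw [hγ c a]
    rw [hc, sum_gaugeN_mul, h.sum_n_mul_γ hγ, hV]
    simp only [gaugeN2, gaugeL]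
    field_simp
    ring

section DerivedFields

variable {m : ℕ}

/-- Christoffel symbols of the first kind of `γ`, the lowered index coming last. -/
def chrLow (γ : Ten m) (x : Fin m → ℝ) (a b d : Fin m) : ℝ :=
  (pd a (fun y => γ y b d) x + pd b (fun y => γ y a d) x - pd d (fun y => γ y a b) x) / 2

/-- `½(∂_aℓ_b + ∂_bℓ_a) − Y_{ab}`. -/
def symDefect (ℓ : Vec m) (Y : Ten m) (x : Fin m → ℝ) (a b : Fin m) : ℝ :=
  (pd a (fun y => ℓ y b) x + pd b (fun y => ℓ y a) x) / 2 - Y x a b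

theorem GamB_eq (γ : Ten m) (ℓ : Vec m) (P : Ten m) (n : Vec m) (Y : Ten m)
    (x : Fin m → ℝ) (c a b : Fin m) :
    GamB γ ℓ P n Y x c a b
      = (∑ d, P x c d * chrLow γ x a b d) + n x c * symDefect ℓ Y x a b := by
  simp only [GamB, Gam0, chrLow, symDefect, Finset.sum_div, mul_div_assoc]
  ring

theorem add_Ff_eq (ℓ : Vec m) (Y : Ten m) (x : Fin m → ℝ) (a b : Fin m) :
    Y x a b + Ff ℓ x a b = pd a (fun y => ℓ y b) x - symDefect ℓ Y x a b := by
  simp only [Ff, symDefect]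
  ring

theorem Kf_eq {γ : Ten m} {ℓ n : Vec m} {n2 : Sc m} (Y : Ten m) {x : Fin m → ℝ}
    (hγd : ∀ a b, DifferentiableAt ℝ (fun y => γ y a b) x)
    (hℓd : ∀ a, DifferentiableAt ℝ (fun y => ℓ y a) x)
    (hnd : ∀ a, DifferentiableAt ℝ (fun y => n y a) x)
    (hn2d : DifferentiableAt ℝ n2 x)
    (hγ : ∀ᶠ y in nhds x, ∀ a b, γ y a b = γ y b a)
    (h : ∀ᶠ y in nhds x, ∀ a, (∑ b, γ y a b * n y b) + n2 y * ℓ y a = 0) (a b : Fin m) :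
    Kf γ ℓ n n2 Y x a b
      = -((∑ d, n x d * chrLow γ x a b d) + n2 x * symDefect ℓ Y x a b) := by
  have key : ∀ a b, (∑ c, pd a (fun y => γ y b c) x * n x c)
      + (∑ c, γ x b c * pd a (fun y => n y c) x)
      + (pd a n2 x * ℓ x b + n2 x * pd a (fun y => ℓ y b) x) = 0 := by
    intro a b
    rw [← pd_sum_mul (hγd b) hnd, ← pd_mul hn2d (hℓd b),
      ← pd_add (DifferentiableAt.fun_sum fun c _ => (hγd b c).fun_mul (hnd c)) (hn2d.fun_mul (hℓd b)),
      ← pd_const (x := x) 0 a]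
    exact pd_congr (h.mono fun y hy => hy b) a
  have hsum : (∑ d, n x d * chrLow γ x a b d)
      = ((∑ c, pd a (fun y => γ y b c) x * n x c)
        + (∑ c, pd b (fun y => γ y a c) x * n x c)
        - ∑ c, n x c * pd c (fun y => γ y a b) x) / 2 := by
    rw [← Finset.sum_add_distrib, ← Finset.sum_sub_distrib, Finset.sum_div]
    exact Finset.sum_congr rfl fun c _ => by rw [chrLow]; ring
  have hγx := hγ.self_of_nhds
  have hsymm : ∑ c, γ x c b * pd a (fun y => n y c) x
      = ∑ c, γ x b c * pd a (fun y => n y c) x :=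
    Finset.sum_congr rfl fun c _ => by rw [hγx c b]
  rw [hsum]
  simp only [Kf, Uf, symDefect, Finset.sum_add_distrib]
  rw [hsymm]
  linear_combination (key a b + key b a) / 2

end DerivedFields

section GaugeDerivatives

variable {m : ℕ} {γ : Ten m} {ℓ V : Vec m} {ℓ2 u : Sc m} {x : Fin m → ℝ}

theorem differentiableAt_lower
    (hγd : ∀ a b, DifferentiableAt ℝ (fun y => γ y a b) x)
    (hVd : ∀ a, DifferentiableAt ℝ (fun y => V y a) x) (b : Fin m) :
    DifferentiableAt ℝ (fun y => ∑ c, V y c * γ y b c) x :=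
  DifferentiableAt.fun_sum fun c _ => (hVd c).mul (hγd b c)

theorem differentiableAt_gaugeL
    (hγd : ∀ a b, DifferentiableAt ℝ (fun y => γ y a b) x)
    (hℓd : ∀ a, DifferentiableAt ℝ (fun y => ℓ y a) x)
    (hud : DifferentiableAt ℝ u x)
    (hVd : ∀ a, DifferentiableAt ℝ (fun y => V y a) x) (b : Fin m) :
    DifferentiableAt ℝ (fun y => gaugeL γ ℓ u V y b) x :=
  hud.mul ((hℓd b).add (differentiableAt_lower hγd hVd b))

theorem pd_gaugeL
    (hγd : ∀ a b, DifferentiableAt ℝ (fun y => γ y a b) x)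
    (hℓd : ∀ a, DifferentiableAt ℝ (fun y => ℓ y a) x)
    (hud : DifferentiableAt ℝ u x)
    (hVd : ∀ a, DifferentiableAt ℝ (fun y => V y a) x) (a b : Fin m) :
    pd a (fun y => gaugeL γ ℓ u V y b) x
      = pd a u x * (ℓ x b + ∑ c, V x c * γ x b c)
        + u x * (pd a (fun y => ℓ y b) x + ((∑ c, pd a (fun y => V y c) x * γ x b c)
          + ∑ c, V x c * pd a (fun y => γ y b c) x)) := by
  have hlow := differentiableAt_lower hγd hVd b
  simp only [gaugeL]
  rw [pd_mul hud ((hℓd b).fun_add hlow), pd_add (hℓd b) hlow, pd_sum_mul hVd (hγd b)]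

theorem pd_gaugeL2
    (hγd : ∀ a b, DifferentiableAt ℝ (fun y => γ y a b) x)
    (hγ : ∀ a b, γ x a b = γ x b a)
    (hℓd : ∀ a, DifferentiableAt ℝ (fun y => ℓ y a) x)
    (hℓ2d : DifferentiableAt ℝ ℓ2 x)
    (hud : DifferentiableAt ℝ u x)
    (hVd : ∀ a, DifferentiableAt ℝ (fun y => V y a) x) (a : Fin m) :
    pd a (gaugeL2 γ ℓ ℓ2 u V) x
      = 2 * u x * pd a u x * (ℓ2 x + 2 * (∑ c, V x c * ℓ x c)
          + ∑ c, V x c * ∑ d, V x d * γ x c d)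
        + u x ^ 2 * (pd a ℓ2 x
          + 2 * ((∑ c, pd a (fun y => V y c) x * ℓ x c)
            + ∑ c, V x c * pd a (fun y => ℓ y c) x)
          + (2 * (∑ c, V x c * ∑ d, pd a (fun y => V y d) x * γ x c d)
            + ∑ c, V x c * ∑ d, V x d * pd a (fun y => γ y c d) x)) := by
  have hlow := differentiableAt_lower hγd hVd
  have hVℓ : DifferentiableAt ℝ (fun y => ∑ c, V y c * ℓ y c) x :=
    DifferentiableAt.fun_sum fun c _ => (hVd c).mul (hℓd c)
  have hVV : DifferentiableAt ℝ (fun y => ∑ c, V y c * ∑ d, V y d * γ y c d) x :=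
    DifferentiableAt.fun_sum fun c _ => (hVd c).mul (hlow c)
  have h2 : DifferentiableAt ℝ (fun y => 2 * ∑ c, V y c * ℓ y c) x := hVℓ.const_mul 2
  have hfun : gaugeL2 γ ℓ ℓ2 u V = fun y => u y * u y * (ℓ2 y + 2 * (∑ c, V y c * ℓ y c)
      + ∑ c, V y c * ∑ d, V y d * γ y c d) :=
    funext fun y => by rw [gaugeL2_eq, sq]
  have hswap : ∑ c, pd a (fun y => V y c) x * ∑ d, V x d * γ x c d
      = ∑ c, V x c * ∑ d, pd a (fun y => V y d) x * γ x c d := by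
    rw [sum_mul_sum_swap]
    exact Finset.sum_congr rfl fun c _ => by
      congr 1
      exact Finset.sum_congr rfl fun d _ => by rw [hγ d c]
  have hVVd : pd a (fun y => ∑ c, V y c * ∑ d, V y d * γ y c d) x
      = 2 * (∑ c, V x c * ∑ d, pd a (fun y => V y d) x * γ x c d)
        + ∑ c, V x c * ∑ d, V x d * pd a (fun y => γ y c d) x := by
    rw [pd_sum_mul (k := fun c y => ∑ d, V y d * γ y c d) hVd hlow, hswap]
    simp only [pd_sum_mul hVd (hγd _), mul_add, Finset.sum_add_distrib]
    ring
  rw [hfun, pd_mul (hud.fun_mul hud) ((hℓ2d.fun_add h2).fun_add hVV), pd_mul hud hud,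
    pd_add (hℓ2d.fun_add h2) hVV, pd_add hℓ2d h2,
    pd_mul (differentiableAt_const 2) hVℓ, pd_const, pd_sum_mul hVd hℓd, hVVd]
  ring

theorem symDefect_gauge (Y : Ten m)
    (hγd : ∀ a b, DifferentiableAt ℝ (fun y => γ y a b) x)
    (hγ : ∀ a b, γ x a b = γ x b a)
    (hℓd : ∀ a, DifferentiableAt ℝ (fun y => ℓ y a) x)
    (hud : DifferentiableAt ℝ u x)
    (hVd : ∀ a, DifferentiableAt ℝ (fun y => V y a) x) (a b : Fin m) :
    symDefect (gaugeL γ ℓ u V) (gaugeY γ ℓ Y u V) x a b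
      = u x * (symDefect ℓ Y x a b + ∑ c, V x c * chrLow γ x a b c) := by
  have huV : ∀ a b, ∑ c, γ x b c * pd a (fun y => u y * V y c) x
      = pd a u x * (∑ c, V x c * γ x b c)
        + u x * ∑ c, pd a (fun y => V y c) x * γ x b c := by
    intro a b
    simp only [Finset.mul_sum, ← Finset.sum_add_distrib]
    exact Finset.sum_congr rfl fun c _ => by rw [pd_mul hud (hVd c)]; ring
  have hsymm : ∑ c, γ x c b * pd a (fun y => u y * V y c) x
      = ∑ c, γ x b c * pd a (fun y => u y * V y c) x :=
    Finset.sum_congr rfl fun c _ => by rw [hγ c b]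
  have hchr : ∑ c, V x c * chrLow γ x a b c
      = ((∑ c, V x c * pd a (fun y => γ y b c) x) + (∑ c, V x c * pd b (fun y => γ y a c) x)
        - ∑ c, V x c * pd c (fun y => γ y a b) x) / 2 := by
    rw [← Finset.sum_add_distrib, ← Finset.sum_sub_distrib, Finset.sum_div]
    exact Finset.sum_congr rfl fun c _ => by rw [chrLow]; ring
  rw [hchr]
  simp only [symDefect, gaugeY]
  rw [pd_gaugeL hγd hℓd hud hVd, pd_gaugeL hγd hℓd hud hVd, hsymm, huV, huV]
  ring

/-- Contraction of the gauge-transformed `Y_{ab} + F_{ab}` in its second index. -/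
theorem sum_mul_gauge_add_Ff (Y : Ten m)
    (hγd : ∀ a b, DifferentiableAt ℝ (fun y => γ y a b) x)
    (hγ : ∀ᶠ y in nhds x, ∀ a b, γ y a b = γ y b a)
    (hℓd : ∀ a, DifferentiableAt ℝ (fun y => ℓ y a) x)
    (hud : DifferentiableAt ℝ u x)
    (hVd : ∀ a, DifferentiableAt ℝ (fun y => V y a) x) (a : Fin m) (f : Fin m → ℝ) :
    ∑ b, f b * (gaugeY γ ℓ Y u V x a b + Ff (gaugeL γ ℓ u V) x a b)
      = u x * (∑ b, f b * (Y x a b + Ff ℓ x a b))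
        + pd a u x * ((∑ b, f b * ℓ x b) + ∑ b, f b * ∑ c, V x c * γ x b c)
        + u x * (∑ b, f b * ∑ c, pd a (fun y => V y c) x * γ x b c)
        + u x * ∑ c, V x c * ∑ b, f b * chrLow γ x a c b := by
  rw [← sum_mul_sum_swap f (V x) fun b c => chrLow γ x a c b]
  simp only [Finset.mul_sum (s := Finset.univ) (a := u x),
    Finset.mul_sum (s := Finset.univ) (a := pd a u x), ← Finset.sum_add_distrib]
  refine Finset.sum_congr rfl fun b _ => ?_
  have hchr : ∑ c, V x c * chrLow γ x a c b
      = (∑ c, V x c * pd a (fun y => γ y b c) x) - ∑ c, V x c * chrLow γ x a b c := by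
    rw [← Finset.sum_sub_distrib]
    refine Finset.sum_congr rfl fun c _ => ?_
    have hcb : pd a (fun y => γ y c b) x = pd a (fun y => γ y b c) x :=
      pd_congr (hγ.mono fun y hy => hy c b) a
    simp only [chrLow]
    rw [hcb]
    ring
  rw [add_Ff_eq, add_Ff_eq, symDefect_gauge Y hγd hγ.self_of_nhds hℓd hud hVd,
    pd_gaugeL hγd hℓd hud hVd, hchr]
  ring

theorem sum_mul_sum_mul_pd (hγ : ∀ᶠ y in nhds x, ∀ a b, γ y a b = γ y b a) (a : Fin m)
    (v : Fin m → ℝ) :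
    ∑ c, v c * ∑ d, v d * pd a (fun y => γ y c d) x
      = 2 * ∑ c, v c * ∑ d, v d * chrLow γ x a c d := by
  have hswap := sum_mul_sum_swap v v fun c d => chrLow γ x a c d
  rw [two_mul]
  nth_rewrite 2 [hswap]
  simp only [← Finset.sum_add_distrib, ← mul_add]
  refine Finset.sum_congr rfl fun c _ => ?_
  congr 1
  refine Finset.sum_congr rfl fun d _ => ?_
  have hcd : pd a (fun y => γ y d c) x = pd a (fun y => γ y c d) x :=
    pd_congr (hγ.mono fun y hy => hy d c) a
  simp only [chrLow]
  rw [hcd]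
  ring

end GaugeDerivatives

end HypData

open HypData in
/-- Lemma 4 of the paper, gauge transformation of the inverse blocks
and of the derived fields `Γ̄, K, φ, Ψ`. -/
theorem statement7 (m : ℕ) (hm : 1 ≤ m) (U : Set (Fin m → ℝ)) (hU : IsOpen U)
    (γ : Ten m) (ℓ : Vec m) (ℓ2 : Sc m) (P : Ten m) (n : Vec m) (n2 : Sc m)
    (hdata : MetricData U γ ℓ ℓ2 P n n2)
    (Y : Ten m) (hYsm : SmTen U Y) (hYs : ∀ x ∈ U, ∀ a b, Y x a b = Y x b a)
    (u : Sc m) (V : Vec m) (husm : SmSc U u) (hVsm : SmVec U V)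
    (hu : ∀ x ∈ U, u x ≠ 0) :
    -- (a) the primed matrix is invertible with the stated inverse blocks
    ((∀ x ∈ U, InvBlocks (γ x) (gaugeL γ ℓ u V x) (gaugeL2 γ ℓ ℓ2 u V x)
        (gaugeP P n n2 V x) (gaugeN n n2 u V x) (gaugeN2 n2 u x))
    -- (b) Γ̄' = Γ̄ + V K
    ∧ (∀ x ∈ U, ∀ c a b,
        GamB γ (gaugeL γ ℓ u V) (gaugeP P n n2 V) (gaugeN n n2 u V)
            (gaugeY γ ℓ Y u V) x c a b
          = GamB γ ℓ P n Y x c a b + V x c * Kf γ ℓ n n2 Y x a b)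
    -- (c) K' = u⁻¹ K
    ∧ (∀ x ∈ U, ∀ a b,
        Kf γ (gaugeL γ ℓ u V) (gaugeN n n2 u V) (gaugeN2 n2 u)
            (gaugeY γ ℓ Y u V) x a b
          = (u x)⁻¹ * Kf γ ℓ n n2 Y x a b)
    -- (d) φ' = φ + u⁻¹∂u − K V
    ∧ (∀ x ∈ U, ∀ a,
        phif (gaugeL γ ℓ u V) (gaugeL2 γ ℓ ℓ2 u V) (gaugeN n n2 u V)
            (gaugeN2 n2 u) (gaugeY γ ℓ Y u V) x a
          = phif ℓ ℓ2 n n2 Y x a + (u x)⁻¹ * pd a u x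
            - ∑ b, Kf γ ℓ n n2 Y x a b * V x b)
    -- (e) Ψ' = u (Ψ + ∇̄V − φV + K V V)
    ∧ (∀ x ∈ U, ∀ b a,
        Psif (gaugeL γ ℓ u V) (gaugeL2 γ ℓ ℓ2 u V) (gaugeP P n n2 V)
            (gaugeN n n2 u V) (gaugeY γ ℓ Y u V) x b a
          = u x * (Psif ℓ ℓ2 P n Y x b a + covD1U (GamB γ ℓ P n Y) V x a b
            - phif ℓ ℓ2 n n2 Y x a * V x b
            + (∑ d, Kf γ ℓ n n2 Y x a d * V x d) * V x b))) := by
  obtain ⟨hγsm, hℓsm, hℓ2sm, -, hnsm, hn2sm, hγs, -, hinv⟩ := hdata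
  have hdiff : ∀ {f : Sc m}, ContDiffOn ℝ (⊤ : ℕ∞) f U → ∀ x ∈ U, DifferentiableAt ℝ f x :=
    fun hf x hx => (hf.contDiffAt (hU.mem_nhds hx)).differentiableAt (by simp)
  have hγd : ∀ x ∈ U, ∀ a b, DifferentiableAt ℝ (fun y => γ y a b) x :=
    fun x hx a b => hdiff (hγsm a b) x hx
  have hℓd : ∀ x ∈ U, ∀ a, DifferentiableAt ℝ (fun y => ℓ y a) x :=
    fun x hx a => hdiff (hℓsm a) x hx
  have hnd : ∀ x ∈ U, ∀ a, DifferentiableAt ℝ (fun y => n y a) x :=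
    fun x hx a => hdiff (hnsm a) x hx
  have hVd : ∀ x ∈ U, ∀ a, DifferentiableAt ℝ (fun y => V y a) x :=
    fun x hx a => hdiff (hVsm a) x hx
  have hud := hdiff husm
  have hn2d := hdiff hn2sm
  have hℓ2d := hdiff hℓ2sm
  have hγev : ∀ x ∈ U, ∀ᶠ y in nhds x, ∀ a b, γ y a b = γ y b a :=
    fun x hx => Filter.eventually_of_mem (hU.mem_nhds hx) hγs
  have hinv' : ∀ x ∈ U, InvBlocks (γ x) (gaugeL γ ℓ u V x) (gaugeL2 γ ℓ ℓ2 u V x)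
      (gaugeP P n n2 V x) (gaugeN n n2 u V x) (gaugeN2 n2 u x) :=
    fun x hx => invBlocks_gauge V (hγs x hx) (hinv x hx) (hu x hx)
  have hK : ∀ x ∈ U, ∀ a b, Kf γ ℓ n n2 Y x a b
      = -((∑ d, n x d * chrLow γ x a b d) + n2 x * symDefect ℓ Y x a b) :=
    fun x hx => Kf_eq Y (hγd x hx) (hℓd x hx) (hnd x hx) (hn2d x hx) (hγev x hx)
      (Filter.eventually_of_mem (hU.mem_nhds hx) fun y hy => (hinv y hy).2.2.2)
  have hQ : ∀ x ∈ U, ∀ a b, symDefect (gaugeL γ ℓ u V) (gaugeY γ ℓ Y u V) x a b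
      = u x * (symDefect ℓ Y x a b + ∑ c, V x c * chrLow γ x a b c) :=
    fun x hx => symDefect_gauge Y (hγd x hx) (hγs x hx) (hℓd x hx) (hud x hx) (hVd x hx)
  have hKV : ∀ x ∈ U, ∀ a, ∑ b, Kf γ ℓ n n2 Y x a b * V x b
      = -((∑ c, V x c * ∑ b, n x b * chrLow γ x a c b)
        + n2 x * ∑ b, V x b * symDefect ℓ Y x a b) := by
    intro x hx a
    rw [Finset.mul_sum, ← Finset.sum_add_distrib, ← Finset.sum_neg_distrib]
    exact Finset.sum_congr rfl fun b _ => by rw [hK x hx]; ring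
  have hVW : ∀ x a, ∑ b, V x b * pd a (fun y => ℓ y b) x
      = (∑ b, V x b * (Y x a b + Ff ℓ x a b)) + ∑ b, V x b * symDefect ℓ Y x a b := by
    intro x a
    rw [← Finset.sum_add_distrib]
    exact Finset.sum_congr rfl fun b _ => by rw [add_Ff_eq]; ring
  have hW := fun x (hx : x ∈ U) => sum_mul_gauge_add_Ff Y (hγd x hx) (hγev x hx) (hℓd x hx)
    (hud x hx) (hVd x hx)
  have hL2 := fun x (hx : x ∈ U) => pd_gaugeL2 (hγd x hx) (hγs x hx) (hℓd x hx) (hℓ2d x hx)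
    (hud x hx) (hVd x hx)
  have hφ : ∀ x ∈ U, ∀ a,
      phif (gaugeL γ ℓ u V) (gaugeL2 γ ℓ ℓ2 u V) (gaugeN n n2 u V)
          (gaugeN2 n2 u) (gaugeY γ ℓ Y u V) x a
        = phif ℓ ℓ2 n n2 Y x a + (u x)⁻¹ * pd a u x
          - ∑ b, Kf γ ℓ n n2 Y x a b * V x b := by
    intro x hx a
    have hux := hu x hx
    have hnℓ := (hinv x hx).2.2.1
    have hlow := (hinv x hx).sum_n_mul_lower (hγs x hx)
    have hVV := sum_mul_sum_swap (V x) (V x) fun c d => chrLow γ x a d c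
    rw [hKV x hx]
    simp only [phif]
    rw [sum_gaugeN_mul, hW x hx, hW x hx, hL2 x hx, hlow, hlow,
      sum_mul_sum_mul_pd (hγev x hx), hVW]
    simp only [gaugeN2]
    field_simp
    linear_combination 2 * pd a u x * hnℓ
  refine ⟨hinv', fun x hx c a b => ?_, fun x hx a b => ?_, hφ, fun x hx b a => ?_⟩
  · have hux := hu x hx
    rw [GamB_eq, GamB_eq, sum_gaugeP_mul, hQ x hx, hK x hx]
    simp only [gaugeN]
    field_simp
    ring
  · have hux := hu x hx
    have hK' := Kf_eq (gaugeY γ ℓ Y u V) (ℓ := gaugeL γ ℓ u V) (n := gaugeN n n2 u V)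
      (n2 := gaugeN2 n2 u) (hγd x hx)
      (differentiableAt_gaugeL (hγd x hx) (hℓd x hx) (hud x hx) (hVd x hx))
      (fun c => ((hud x hx).inv hux).mul ((hnd x hx c).sub ((hn2d x hx).mul (hVd x hx c))))
      ((((hud x hx).pow 2).inv (pow_ne_zero 2 hux)).mul (hn2d x hx)) (hγev x hx)
      (Filter.eventually_of_mem (hU.mem_nhds hx) fun y hy => (hinv' y hy).2.2.2) a b
    rw [hK', hQ x hx, hK x hx, sum_gaugeN_mul]
    simp only [gaugeN2]
    field_simp
    ring
  · have hux := hu x hx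
    have hφx := hφ x hx a
    have hPℓ := (hinv x hx).2.1 b
    have hlow := (hinv x hx).sum_P_mul_lower
    have hΓ : ∑ d, GamB γ ℓ P n Y x b a d * V x d
        = (∑ d, V x d * ∑ c, P x b c * chrLow γ x a d c)
          + n x b * ∑ d, V x d * symDefect ℓ Y x a d := by
      rw [Finset.mul_sum, ← Finset.sum_add_distrib]
      exact Finset.sum_congr rfl fun d _ => by rw [GamB_eq]; ring
    have hΨφ : Psif (gaugeL γ ℓ u V) (gaugeL2 γ ℓ ℓ2 u V) (gaugeP P n n2 V)
          (gaugeN n n2 u V) (gaugeY γ ℓ Y u V) x b a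
        = (∑ c, P x b c * (gaugeY γ ℓ Y u V x a c + Ff (gaugeL γ ℓ u V) x a c))
          + n x b * ((u x)⁻¹ * pd a (gaugeL2 γ ℓ ℓ2 u V) x / 2
            - ∑ c, V x c * (gaugeY γ ℓ Y u V x a c + Ff (gaugeL γ ℓ u V) x a c))
          - u x * V x b * phif (gaugeL γ ℓ u V) (gaugeL2 γ ℓ ℓ2 u V) (gaugeN n n2 u V)
            (gaugeN2 n2 u) (gaugeY γ ℓ Y u V) x a := by
      simp only [Psif, phif]
      rw [sum_gaugeP_mul, sum_gaugeN_mul]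
      simp only [gaugeN, gaugeN2]
      field_simp
      ring
    rw [hΨφ, hφx, hW x hx, hW x hx, hL2 x hx, hlow, hlow,
      sum_mul_sum_mul_pd (hγev x hx), hVW]
    simp only [Psif, covD1U]
    rw [hΓ]
    field_simp
    linear_combination 2 * pd a u x * hPℓ
end
end

section
/- Let (γ, ℓ, ℓ⁽²⁾, Y) be coordinate hypersurface data on U with inverse blocks (P, n, n⁽²⁾), derived fields F, U, K, Γ̊, Γ̄, curvatures R̊, R̄, and the fields (I)_{bcd}, (II)_{abcd} as defined below. Then the following two identities hold on U: (1) (I)_{bcd}P^{bd}n^c + ½(II)_{abcd}P^{ac}P^{bd} = ½R̊^c_{bcd}P^{bd} + ½ℓ_aR̊^a_{bcd}P^{bd}n^c + ∇̊_d((P^{bd}n^c − P^{bc}n^d)Y_{bc}) + ½n⁽²⁾P^{bd}P^{ac}(Y_{bc}Y_{da} − Y_{bd}Y_{ca}) + ½(P^{bd}n^c − P^{bc}n^d)[ℓ⁽²⁾∇̊_dU_{bc} + (U_{bc} + n⁽²⁾Y_{bc})∂_dℓ⁽²⁾ + 2Y_{bc}(F_{df} − Y_{df})n^f]; (2) (I)_{bcd}(n⁽²⁾P^{bd}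 − n^bn^d) + (II)_{abcd}n^aP^{bd} = −ℓ_aR̊^a_{bcd}n^bn^d + ∇̊_f[(n⁽²⁾P^{bd} − n^bn^d)(δ^f_dY_{bc} − δ^f_cY_{bd})] + (P^{bd} − ℓ⁽²⁾n^bn^d)(∇̊_dU_{bc} − ∇̊_cU_{bd}) + (n⁽²⁾P^{bd} − n^bn^d)[½(U_{bc} + n⁽²⁾Y_{bc})∂_dℓ⁽²⁾ − ½(U_{bd} + n⁽²⁾Y_{bd})∂_cℓ⁽²⁾ + (Y_{bc}F_{df} − Y_{bd}F_{cf})n^f] + (P^{bd}n^f − P^{bf}n^d)Y_{bd}U_{cf} + P^{bd}n^f(U_{bc}F_{df} − U_{bd}F_{cf}). (For embedded data the left-hand sides equal −G(n,ℓ) and −G(n,e_c); these are the constraint equations for a general hypersurface written with the metric hypersurface connection Γ̊, with all dependence on the extrinsic tensor Y explicit.) -/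
open scoped BigOperators

noncomputable section

namespace GaussCodazzi

open HypData

variable {m : ℕ}

/-- The Gauss-Codazzi quantity `(I)_{bcd}` (= `R(ℓ,e_b,e_c,e_d)` for embedded data). -/
def Idef (γ : Ten m) (ℓ : Vec m) (ℓ2 : Sc m) (P : Ten m) (n : Vec m) (n2 : Sc m)
    (Y : Ten m) (x : Fin m → ℝ) (b c d : Fin m) : ℝ :=
  (∑ a, ℓ x a * curv (GamB γ ℓ P n Y) x a b c d)
  + ℓ2 x * (covD2 (GamB γ ℓ P n Y) (Kf γ ℓ n n2 Y) x d b c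
      - covD2 (GamB γ ℓ P n Y) (Kf γ ℓ n n2 Y) x c b d)
  + Kf γ ℓ n n2 Y x b c * pd d ℓ2 x / 2
  - Kf γ ℓ n n2 Y x b d * pd c ℓ2 x / 2

/-- The Gauss-Codazzi quantity `(II)_{abcd}` (= `R(e_a,e_b,e_c,e_d)` for embedded data). -/
def IIdef (γ : Ten m) (ℓ : Vec m) (ℓ2 : Sc m) (P : Ten m) (n : Vec m) (n2 : Sc m)
    (Y : Ten m) (x : Fin m → ℝ) (a b c d : Fin m) : ℝ :=
  (∑ f, γ x a f * curv (GamB γ ℓ P n Y) x f b c d)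
  - Kf γ ℓ n n2 Y x b d * (covD1 (GamB γ ℓ P n Y) ℓ x c a
      + ℓ2 x * Kf γ ℓ n n2 Y x c a)
  + Kf γ ℓ n n2 Y x b c * (covD1 (GamB γ ℓ P n Y) ℓ x d a
      + ℓ2 x * Kf γ ℓ n n2 Y x d a)
  - ℓ x a * (covD2 (GamB γ ℓ P n Y) (Kf γ ℓ n n2 Y) x c b d
      - covD2 (GamB γ ℓ P n Y) (Kf γ ℓ n n2 Y) x d b c)

/-! ### Calculus of partial derivatives -/

lemma pd_add {f g : Sc m} {x : Fin m → ℝ} (a : Fin m) (hf : DifferentiableAt ℝ f x)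
    (hg : DifferentiableAt ℝ g x) :
    pd a (fun y => f y + g y) x = pd a f x + pd a g x := by
  simp [pd, fderiv_fun_add hf hg]

lemma pd_sub {f g : Sc m} {x : Fin m → ℝ} (a : Fin m) (hf : DifferentiableAt ℝ f x)
    (hg : DifferentiableAt ℝ g x) :
    pd a (fun y => f y - g y) x = pd a f x - pd a g x := by
  simp [pd, fderiv_fun_sub hf hg]

lemma pd_mul {f g : Sc m} {x : Fin m → ℝ} (a : Fin m) (hf : DifferentiableAt ℝ f x)
    (hg : DifferentiableAt ℝ g x) :
    pd a (fun y => f y * g y) x = pd a f x * g x + f x * pd a g x := by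
  simp [pd, fderiv_fun_mul hf hg]
  ring

lemma pd_sum {ι : Type*} (s : Finset ι) {f : ι → Sc m} {x : Fin m → ℝ} (a : Fin m)
    (hf : ∀ i, DifferentiableAt ℝ (f i) x) :
    pd a (fun y => ∑ i ∈ s, f i y) x = ∑ i ∈ s, pd a (f i) x := by
  simp [pd, fderiv_fun_sum (fun i _ => hf i)]

lemma pd_const (a : Fin m) (r : ℝ) (x : Fin m → ℝ) : pd a (fun _ => r) x = 0 := by
  simp [pd]

lemma pd_congr {U : Set (Fin m → ℝ)} (hU : IsOpen U) {f g : Sc m} {x : Fin m → ℝ}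
    (hx : x ∈ U) (h : ∀ y ∈ U, f y = g y) (a : Fin m) : pd a f x = pd a g x := by
  have : f =ᶠ[nhds x] g := Filter.eventually_of_mem (hU.mem_nhds hx) h
  simp [pd, this.fderiv_eq]

lemma differentiableAt_pd {U : Set (Fin m → ℝ)} (hU : IsOpen U) {f : Sc m}
    (hf : ContDiffOn ℝ (⊤ : ℕ∞) f U) {x : Fin m → ℝ} (hx : x ∈ U) (a : Fin m) :
    DifferentiableAt ℝ (fun y => pd a f y) x := by
  have h1 : ContDiffAt ℝ (⊤ : ℕ∞) f x := hf.contDiffAt (hU.mem_nhds hx)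
  have h2 : ContDiffAt ℝ 1 (fderiv ℝ f) x := h1.fderiv_right (by norm_cast)
  exact (h2.differentiableAt one_ne_zero).clm_apply (differentiableAt_const _)

lemma differentiableAt_of_smooth {U : Set (Fin m → ℝ)} (hU : IsOpen U) {f : Sc m}
    (hf : ContDiffOn ℝ (⊤ : ℕ∞) f U) {x : Fin m → ℝ} (hx : x ∈ U) :
    DifferentiableAt ℝ f x :=
  (hf.contDiffAt (hU.mem_nhds hx)).differentiableAt (by simp)

lemma kd_comm (a b : Fin m) : kd a b = kd b a := by
  simp [kd, eq_comm]

lemma sum_mul_kd (f : Fin m → ℝ) (a : Fin m) : ∑ b, f b * kd b a = f a := by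
  simp [kd]

lemma sum_kd_mul (f : Fin m → ℝ) (a : Fin m) : ∑ b, kd a b * f b = f a := by
  simp [kd]

lemma differentiableAt_Uf {U : Set (Fin m → ℝ)} (hU : IsOpen U) {γ : Ten m} {ℓ n : Vec m}
    {n2 : Sc m} (hγ : SmTen U γ) (hℓ : SmVec U ℓ) (hn : SmVec U n) (hn2 : SmSc U n2)
    {x : Fin m → ℝ} (hx : x ∈ U) (a b : Fin m) :
    DifferentiableAt ℝ (fun y => Uf γ ℓ n n2 y a b) x := by
  have dγ := fun a b => differentiableAt_of_smooth hU (hγ a b) hx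
  have dℓ := fun a => differentiableAt_of_smooth hU (hℓ a) hx
  have dn := fun a => differentiableAt_of_smooth hU (hn a) hx
  have pγ := fun c a b => differentiableAt_pd hU (hγ a b) hx c
  have pn := fun c a => differentiableAt_pd hU (hn a) hx c
  have pn2 := fun c => differentiableAt_pd hU hn2 hx c
  have h : DifferentiableAt ℝ (fun y => (∑ c, (n y c * pd c (fun z => γ z a b) y
      + γ y c b * pd a (fun z => n z c) y + γ y a c * pd b (fun z => n z c) y))
      + ℓ y a * pd b n2 y + ℓ y b * pd a n2 y) x :=
    ((DifferentiableAt.fun_sum fun c _ =>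
      (((dn c).fun_mul (pγ c a b)).fun_add ((dγ c b).fun_mul (pn a c))).fun_add
        ((dγ a c).fun_mul (pn b c))).fun_add ((dℓ a).fun_mul (pn2 b))).fun_add
          ((dℓ b).fun_mul (pn2 a))
  simpa only [Uf, div_eq_mul_inv] using h.mul_const (2 : ℝ)⁻¹

lemma differentiableAt_Gam0 {U : Set (Fin m → ℝ)} (hU : IsOpen U) {γ P : Ten m} {ℓ n : Vec m}
    (hγ : SmTen U γ) (hℓ : SmVec U ℓ) (hP : SmTen U P) (hn : SmVec U n)
    {x : Fin m → ℝ} (hx : x ∈ U) (c a b : Fin m) :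
    DifferentiableAt ℝ (fun y => Gam0 γ ℓ P n y c a b) x := by
  have dP := fun a b => differentiableAt_of_smooth hU (hP a b) hx
  have dn := fun a => differentiableAt_of_smooth hU (hn a) hx
  have pγ := fun c a b => differentiableAt_pd hU (hγ a b) hx c
  have pℓ := fun c a => differentiableAt_pd hU (hℓ a) hx c
  have h1 : DifferentiableAt ℝ (fun y => ∑ d, P y c d * (pd a (fun z => γ z b d) y
      + pd b (fun z => γ z a d) y - pd d (fun z => γ z a b) y)) x :=
    DifferentiableAt.fun_sum fun d _ =>
      (dP c d).fun_mul (((pγ a b d).fun_add (pγ b a d)).fun_sub (pγ d a b))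
  have h2 : DifferentiableAt ℝ (fun y => n y c * (pd a (fun z => ℓ z b) y
      + pd b (fun z => ℓ z a) y)) x :=
    (dn c).fun_mul ((pℓ a b).fun_add (pℓ b a))
  simpa only [Gam0, div_eq_mul_inv] using
    (h1.mul_const (2 : ℝ)⁻¹).fun_add (h2.mul_const (2 : ℝ)⁻¹)

/-! ### Leibniz rules for contractions -/

lemma covD1U_contract (Γ : Conn m) {T : Ten m} {ω : Vec m} {x : Fin m → ℝ}
    (hT : ∀ a b, DifferentiableAt ℝ (fun y => T y a b) x)
    (hω : ∀ a, DifferentiableAt ℝ (fun y => ω y a) x) (a d : Fin m) :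
    covD1U Γ (fun y d' => ∑ b, T y b d' * ω y b) x a d
      = ∑ b, (covD2U Γ T x a b d * ω x b + T x b d * covD1 Γ ω x a b) := by
  have hp : pd a (fun y => ∑ b, T y b d * ω y b) x
      = ∑ b, (pd a (fun y => T y b d) x * ω x b + T x b d * pd a (fun y => ω y b) x) := by
    rw [pd_sum _ _ fun b => (hT b d).fun_mul (hω b)]
    exact Finset.sum_congr rfl fun b _ => pd_mul a (hT b d) (hω b)
  have h1 : ∑ b, ∑ f, Γ x b a f * T x f d * ω x b = ∑ b, ∑ f, T x b d * (Γ x f a b * ω x f) := by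
    rw [Finset.sum_comm]
    exact Finset.sum_congr rfl fun b _ => Finset.sum_congr rfl fun f _ => by ring
  have h2 : ∑ f, ∑ b, Γ x d a f * (T x b f * ω x b) = ∑ b, ∑ f, Γ x d a f * T x b f * ω x b := by
    rw [Finset.sum_comm]
    exact Finset.sum_congr rfl fun b _ => Finset.sum_congr rfl fun f _ => by ring
  simp only [covD1U, covD2U, covD1, hp, add_mul, mul_sub, Finset.mul_sum, Finset.sum_mul,
    Finset.sum_add_distrib, Finset.sum_sub_distrib]
  linarith

lemma covD1_contract (Γ : Conn m) {T : Ten m} {X : Vec m} {x : Fin m → ℝ}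
    (hT : ∀ a b, DifferentiableAt ℝ (fun y => T y a b) x)
    (hX : ∀ a, DifferentiableAt ℝ (fun y => X y a) x) (a b : Fin m) :
    covD1 Γ (fun y b' => ∑ c, T y b' c * X y c) x a b
      = ∑ c, (covD2 Γ T x a b c * X x c + T x b c * covD1U Γ X x a c) := by
  have hp : pd a (fun y => ∑ c, T y b c * X y c) x
      = ∑ c, (pd a (fun y => T y b c) x * X x c + T x b c * pd a (fun y => X y c) x) := by
    rw [pd_sum _ _ fun c => (hT b c).fun_mul (hX c)]
    exact Finset.sum_congr rfl fun c _ => pd_mul a (hT b c) (hX c)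
  have h1 : ∑ c, ∑ f, Γ x f a c * T x b f * X x c = ∑ c, ∑ f, T x b c * (Γ x c a f * X x f) := by
    rw [Finset.sum_comm]
    exact Finset.sum_congr rfl fun b _ => Finset.sum_congr rfl fun f _ => by ring
  have h2 : ∑ f, ∑ c, Γ x f a b * (T x f c * X x c) = ∑ c, ∑ f, Γ x f a b * T x f c * X x c := by
    rw [Finset.sum_comm]
    exact Finset.sum_congr rfl fun b _ => Finset.sum_congr rfl fun f _ => by ring
  simp only [covD1U, covD2, covD1, hp, sub_mul, mul_add, Finset.mul_sum, Finset.sum_mul,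
    Finset.sum_add_distrib, Finset.sum_sub_distrib]
  linarith

lemma pd_contract1 (Γ : Conn m) {X ω : Vec m} {x : Fin m → ℝ}
    (hX : ∀ a, DifferentiableAt ℝ (fun y => X y a) x)
    (hω : ∀ a, DifferentiableAt ℝ (fun y => ω y a) x) (a : Fin m) :
    pd a (fun y => ∑ b, X y b * ω y b) x
      = ∑ b, (covD1U Γ X x a b * ω x b + X x b * covD1 Γ ω x a b) := by
  have hp : pd a (fun y => ∑ b, X y b * ω y b) x
      = ∑ b, (pd a (fun y => X y b) x * ω x b + X x b * pd a (fun y => ω y b) x) := by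
    rw [pd_sum _ _ fun b => (hX b).fun_mul (hω b)]
    exact Finset.sum_congr rfl fun b _ => pd_mul a (hX b) (hω b)
  have h1 : ∑ b, ∑ f, Γ x b a f * X x f * ω x b = ∑ b, ∑ f, X x b * (Γ x f a b * ω x f) := by
    rw [Finset.sum_comm]
    exact Finset.sum_congr rfl fun b _ => Finset.sum_congr rfl fun f _ => by ring
  simp only [covD1U, covD1, hp, add_mul, mul_sub, Finset.mul_sum, Finset.sum_mul,
    Finset.sum_add_distrib, Finset.sum_sub_distrib]
  linarith

lemma pd_contract2 (Γ : Conn m) {T S : Ten m} {x : Fin m → ℝ}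
    (hT : ∀ a b, DifferentiableAt ℝ (fun y => T y a b) x)
    (hS : ∀ a b, DifferentiableAt ℝ (fun y => S y a b) x) (a : Fin m) :
    pd a (fun y => ∑ b, ∑ c, T y b c * S y b c) x
      = ∑ b, ∑ c, (covD2U Γ T x a b c * S x b c + T x b c * covD2 Γ S x a b c) := by
  have hp : pd a (fun y => ∑ b, ∑ c, T y b c * S y b c) x
      = ∑ b, ∑ c, (pd a (fun y => T y b c) x * S x b c
        + T x b c * pd a (fun y => S y b c) x) := by
    rw [pd_sum _ _ fun b => DifferentiableAt.fun_sum fun c _ => (hT b c).fun_mul (hS b c)]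
    refine Finset.sum_congr rfl fun b _ => ?_
    rw [pd_sum _ _ fun c => (hT b c).fun_mul (hS b c)]
    exact Finset.sum_congr rfl fun c _ => pd_mul a (hT b c) (hS b c)
  have h1 : ∑ b, ∑ c, ∑ f, Γ x b a f * T x f c * S x b c
      = ∑ b, ∑ c, ∑ f, T x b c * (Γ x f a b * S x f c) := by
    rw [Finset.sum_comm]
    conv_rhs => rw [Finset.sum_comm]
    refine Finset.sum_congr rfl fun c _ => ?_
    rw [Finset.sum_comm]
    exact Finset.sum_congr rfl fun b _ => Finset.sum_congr rfl fun f _ => by ring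
  have h2 : ∑ b, ∑ c, ∑ f, Γ x c a f * T x b f * S x b c
      = ∑ b, ∑ c, ∑ f, T x b c * (Γ x f a c * S x b f) := by
    refine Finset.sum_congr rfl fun b _ => ?_
    rw [Finset.sum_comm]
    exact Finset.sum_congr rfl fun b _ => Finset.sum_congr rfl fun f _ => by ring
  simp only [covD2U, covD2, hp, add_mul, mul_sub, Finset.mul_sum, Finset.sum_mul,
    Finset.sum_add_distrib, Finset.sum_sub_distrib]
  linarith

lemma covD1U_sub_smul (Γ : Conn m) {V X : Vec m} {s : Sc m} {x : Fin m → ℝ}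
    (hV : ∀ a, DifferentiableAt ℝ (fun y => V y a) x)
    (hs : DifferentiableAt ℝ s x) (hX : ∀ a, DifferentiableAt ℝ (fun y => X y a) x)
    (a d : Fin m) :
    covD1U Γ (fun y d' => V y d' - s y * X y d') x a d
      = covD1U Γ V x a d - (pd a s x * X x d + s x * covD1U Γ X x a d) := by
  have hp : pd a (fun y => V y d - s y * X y d) x
      = pd a (fun y => V y d) x - (pd a s x * X x d + s x * pd a (fun y => X y d) x) := by
    rw [pd_sub a (hV d) (hs.fun_mul (hX d)), pd_mul a hs (hX d)]
  have h1 : ∑ f, Γ x d a f * (s x * X x f) = s x * ∑ f, Γ x d a f * X x f := by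
    rw [Finset.mul_sum]
    exact Finset.sum_congr rfl fun f _ => by ring
  simp only [covD1U, hp, mul_sub, Finset.sum_sub_distrib, h1]
  ring

lemma covD2_symm {U : Set (Fin m → ℝ)} (hU : IsOpen U) (Γ : Conn m) {T : Ten m}
    (hT : ∀ x ∈ U, ∀ a b, T x a b = T x b a) {x : Fin m → ℝ} (hx : x ∈ U) (a b c : Fin m) :
    covD2 Γ T x a b c = covD2 Γ T x a c b := by
  simp only [covD2, pd_congr hU hx (fun y hy => hT y hy b c) a]
  have h1 : ∑ d, Γ x d a b * T x d c = ∑ d, Γ x d a b * T x c d :=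
    Finset.sum_congr rfl fun d _ => by rw [hT x hx d c]
  have h2 : ∑ d, Γ x d a c * T x b d = ∑ d, Γ x d a c * T x d b :=
    Finset.sum_congr rfl fun d _ => by rw [hT x hx b d]
  rw [h1, h2]
  ring

/-! ### Covariant derivatives of the metric hypersurface data -/

lemma sum_mulVec_mul (M : Fin m → Fin m → ℝ) (C v : Fin m → ℝ) :
    ∑ d, (∑ e, M d e * C e) * v d = ∑ e, C e * ∑ d, M d e * v d := by
  simp only [Finset.mul_sum, Finset.sum_mul]
  rw [Finset.sum_comm]
  exact Finset.sum_congr rfl fun b _ => Finset.sum_congr rfl fun f _ => by ring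

/-- The relations between the symmetric blocks of a matrix and those of its inverse. -/
structure SymBlocks (γ : Fin m → Fin m → ℝ) (ℓ : Fin m → ℝ) (ℓ2 : ℝ)
    (P : Fin m → Fin m → ℝ) (n : Fin m → ℝ) (n2 : ℝ) : Prop where
  γs : ∀ a b, γ a b = γ b a
  Ps : ∀ a b, P a b = P b a
  Pγ : ∀ a b, ∑ c, P a c * γ c b = kd a b - n a * ℓ b
  Pℓ : ∀ a, ∑ b, P a b * ℓ b = -(ℓ2 * n a)
  nℓ : ∑ a, n a * ℓ a = 1 - n2 * ℓ2
  γn : ∀ a, ∑ b, γ a b * n b = -(n2 * ℓ a)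

lemma symBlocks_of_metricData {U : Set (Fin m → ℝ)} {γ : Ten m} {ℓ : Vec m} {ℓ2 : Sc m} {P : Ten m}
    {n : Vec m} {n2 : Sc m} (h : MetricData U γ ℓ ℓ2 P n n2) {x : Fin m → ℝ} (hx : x ∈ U) :
    SymBlocks (γ x) (ℓ x) (ℓ2 x) (P x) (n x) (n2 x) := by
  obtain ⟨-, -, -, -, -, -, hγ, hP, hI⟩ := h
  obtain ⟨h1, h2, h3, h4⟩ := hI x hx
  exact ⟨hγ x hx, hP x hx, fun a b => by linarith [h1 a b], fun a => by linarith [h2 a],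
    by linarith, fun a => by linarith [h4 a]⟩

section SymBlocks

variable {γ : Fin m → Fin m → ℝ} {ℓ : Fin m → ℝ} {ℓ2 : ℝ}
    {P : Fin m → Fin m → ℝ} {n : Fin m → ℝ} {n2 : ℝ}

lemma SymBlocks.Pγ' (h : SymBlocks γ ℓ ℓ2 P n n2) (a b : Fin m) :
    ∑ c, P c a * γ c b = kd a b - n a * ℓ b := by
  rw [← h.Pγ]
  exact Finset.sum_congr rfl fun c _ => by rw [h.Ps]

lemma SymBlocks.Pℓ' (h : SymBlocks γ ℓ ℓ2 P n n2) (a : Fin m) :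
    ∑ b, P b a * ℓ b = -(ℓ2 * n a) := by
  rw [← h.Pℓ]
  exact Finset.sum_congr rfl fun c _ => by rw [h.Ps]

lemma SymBlocks.γn' (h : SymBlocks γ ℓ ℓ2 P n n2) (a : Fin m) :
    ∑ b, n b * γ b a = -(n2 * ℓ a) := by
  rw [← h.γn]
  exact Finset.sum_congr rfl fun c _ => by rw [h.γs, mul_comm]

lemma SymBlocks.conn_γ (h : SymBlocks γ ℓ ℓ2 P n n2) (C : Fin m → ℝ) (S : ℝ) (b : Fin m) :
    ∑ d, ((∑ e, P d e * C e) / 2 + n d * S / 2) * γ d b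
      = C b / 2 - ℓ b * ((∑ e, n e * C e) + n2 * S) / 2 := by
  have e1 : ∑ d, (∑ e, P d e * C e) * γ d b = C b - ℓ b * ∑ e, n e * C e := by
    rw [sum_mulVec_mul P C fun d => γ d b]
    simp only [h.Pγ', mul_sub, Finset.sum_sub_distrib, sum_mul_kd, Finset.mul_sum]
    congr 1
    exact Finset.sum_congr rfl fun c _ => by ring
  have e2 : ∀ d, ((∑ e, P d e * C e) / 2 + n d * S / 2) * γ d b
      = ((∑ e, P d e * C e) * γ d b) * (1 / 2) + (n d * γ d b) * (S / 2) := fun d => by ring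
  rw [Finset.sum_congr rfl fun d _ => e2 d, Finset.sum_add_distrib, ← Finset.sum_mul,
    ← Finset.sum_mul, e1, h.γn']
  ring

lemma SymBlocks.conn_ℓ (h : SymBlocks γ ℓ ℓ2 P n n2) (C : Fin m → ℝ) (S : ℝ) :
    ∑ d, ((∑ e, P d e * C e) / 2 + n d * S / 2) * ℓ d
      = S / 2 - ℓ2 * ((∑ e, n e * C e) + n2 * S) / 2 := by
  have e1 : ∑ d, (∑ e, P d e * C e) * ℓ d = -(ℓ2 * ∑ e, n e * C e) := by
    rw [sum_mulVec_mul P C ℓ]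
    simp only [h.Pℓ', Finset.mul_sum, ← Finset.sum_neg_distrib]
    exact Finset.sum_congr rfl fun c _ => by ring
  have e2 : ∀ d, ((∑ e, P d e * C e) / 2 + n d * S / 2) * ℓ d
      = ((∑ e, P d e * C e) * ℓ d) * (1 / 2) + (n d * ℓ d) * (S / 2) := fun d => by ring
  rw [Finset.sum_congr rfl fun d _ => e2 d, Finset.sum_add_distrib, ← Finset.sum_mul,
    ← Finset.sum_mul, e1, h.nℓ]
  ring

/-- The derivative of the inverse block matrix in terms of the derivative of the block matrix. -/
lemma SymBlocks.deriv_inverse (h : SymBlocks γ ℓ ℓ2 P n n2)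
    {DP : Fin m → Fin m → ℝ} {Dn u φ : Fin m → ℝ} {Dn2 μ : ℝ}
    (e1 : ∀ a b, (∑ e, (DP a e * γ e b + P a e * (-(ℓ e * u b) - ℓ b * u e)))
      + Dn a * ℓ b + n a * (φ b - ℓ2 * u b) = 0)
    (e2 : ∀ a, (∑ e, (DP a e * ℓ e + P a e * (φ e - ℓ2 * u e))) + μ * n a + ℓ2 * Dn a = 0)
    (e3 : (∑ a, (Dn a * ℓ a + n a * (φ a - ℓ2 * u a))) + Dn2 * ℓ2 + n2 * μ = 0)
    (e4 : ∀ a, (∑ b, ((-(ℓ a * u b) - ℓ b * u a) * n b + γ a b * Dn b))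
      + Dn2 * ℓ a + n2 * (φ a - ℓ2 * u a) = 0) :
    (∀ a b, DP a b = -(n a * ∑ f, P b f * φ f) - n b * (∑ f, P a f * φ f) - n a * n b * μ) ∧
    (∀ a, Dn a = (∑ f, P a f * u f) - n2 * (∑ f, P a f * φ f)
      - n a * ((∑ f, n f * φ f) + n2 * μ)) ∧
    Dn2 = 2 * (∑ f, n f * u f) - 2 * n2 * (∑ f, n f * φ f) - n2 * n2 * μ ∧
    (∑ a, ℓ a * Dn a = -(∑ f, n f * φ f) + ℓ2 * (∑ f, n f * u f) - Dn2 * ℓ2 - n2 * μ) ∧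
    (∀ a, ∑ b, γ a b * Dn b = ℓ a * ((∑ f, n f * u f) - Dn2) + u a - n2 * φ a) := by
  have f1 : ∀ a b, ∑ e, DP a e * γ e b = ℓ b * ((∑ f, P a f * u f) - Dn a) - n a * φ b := by
    intro a b
    have := e1 a b
    have e : ∀ e, DP a e * γ e b + P a e * (-(ℓ e * u b) - ℓ b * u e)
      = DP a e * γ e b - (P a e * ℓ e) * u b - (P a e * u e) * ℓ b := fun e => by ring
    rw [Finset.sum_congr rfl fun f _ => e f, Finset.sum_sub_distrib, Finset.sum_sub_distrib,
      ← Finset.sum_mul, ← Finset.sum_mul, h.Pℓ] at this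
    linarith
  have f2 : ∀ a, ∑ e, DP a e * ℓ e
      = ℓ2 * ((∑ f, P a f * u f) - Dn a) - (∑ f, P a f * φ f) - n a * μ := by
    intro a
    have := e2 a
    have e : ∀ e, DP a e * ℓ e + P a e * (φ e - ℓ2 * u e)
      = DP a e * ℓ e + P a e * φ e - ℓ2 * (P a e * u e) := fun e => by ring
    rw [Finset.sum_congr rfl fun f _ => e f, Finset.sum_sub_distrib, Finset.sum_add_distrib,
      ← Finset.mul_sum] at this
    linarith
  have f3 : ∑ a, Dn a * ℓ a
      = -(∑ f, n f * φ f) + ℓ2 * (∑ f, n f * u f) - Dn2 * ℓ2 - n2 * μ := by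
    have e : ∀ a, Dn a * ℓ a + n a * (φ a - ℓ2 * u a)
      = Dn a * ℓ a + n a * φ a - ℓ2 * (n a * u a) := fun e => by ring
    rw [Finset.sum_congr rfl fun f _ => e f, Finset.sum_sub_distrib, Finset.sum_add_distrib,
      ← Finset.mul_sum] at e3
    linarith
  have f4 : ∀ a, ∑ b, γ a b * Dn b = ℓ a * ((∑ f, n f * u f) - Dn2) + u a - n2 * φ a := by
    intro a
    have := e4 a
    have e : ∀ b, (-(ℓ a * u b) - ℓ b * u a) * n b + γ a b * Dn b
      = γ a b * Dn b - ℓ a * (n b * u b) - (n b * ℓ b) * u a := fun e => by ring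
    rw [Finset.sum_congr rfl fun f _ => e f, Finset.sum_sub_distrib, Finset.sum_sub_distrib,
      ← Finset.mul_sum, ← Finset.sum_mul, h.nℓ] at this
    linarith
  refine ⟨fun a b => ?_, fun a => ?_, ?_, by simpa only [mul_comm] using f3, f4⟩
  · have k1 : DP a b = ∑ e, DP a e * ((∑ c, P b c * γ c e) + n b * ℓ e) := by
      simp only [h.Pγ, sub_add_cancel, kd_comm b, sum_mul_kd]
    have k2 : ∑ e, DP a e * (∑ c, P b c * γ c e) = ∑ c, P b c * ∑ e, DP a e * γ e c := by
      simp only [Finset.mul_sum]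
      rw [Finset.sum_comm]
      exact Finset.sum_congr rfl fun c _ => Finset.sum_congr rfl fun e _ => by
        rw [h.γs c e]; ring
    have k3 : ∑ c, P b c * (ℓ c * ((∑ f, P a f * u f) - Dn a) - n a * φ c)
        = -(ℓ2 * n b) * ((∑ f, P a f * u f) - Dn a) - n a * ∑ f, P b f * φ f := by
      rw [← h.Pℓ, Finset.sum_mul, Finset.mul_sum, ← Finset.sum_sub_distrib]
      exact Finset.sum_congr rfl fun c _ => by ring
    have k4 : ∑ e, DP a e * (n b * ℓ e) = n b * ∑ e, DP a e * ℓ e := by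
      rw [Finset.mul_sum]
      exact Finset.sum_congr rfl fun c _ => by ring
    rw [k1]
    simp only [mul_add, Finset.sum_add_distrib]
    rw [k2, k4]
    simp only [f1, f2]
    rw [k3]
    ring
  · have k1 : Dn a = ∑ b, ((∑ c, P a c * γ c b) + n a * ℓ b) * Dn b := by
      simp only [h.Pγ, sub_add_cancel, sum_kd_mul]
    have k2 : ∑ b, (∑ c, P a c * γ c b) * Dn b = ∑ c, P a c * ∑ b, γ c b * Dn b := by
      simp only [Finset.mul_sum, Finset.sum_mul]
      rw [Finset.sum_comm]
      exact Finset.sum_congr rfl fun c _ => Finset.sum_congr rfl fun e _ => by ring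
    have k3 : ∑ c, P a c * (ℓ c * ((∑ f, n f * u f) - Dn2) + u c - n2 * φ c)
        = -(ℓ2 * n a) * ((∑ f, n f * u f) - Dn2) + (∑ f, P a f * u f)
          - n2 * ∑ f, P a f * φ f := by
      rw [← h.Pℓ, Finset.sum_mul, Finset.mul_sum, ← Finset.sum_add_distrib,
        ← Finset.sum_sub_distrib]
      exact Finset.sum_congr rfl fun c _ => by ring
    have k4 : ∑ e, n a * ℓ e * Dn e = n a * ∑ e, Dn e * ℓ e := by
      rw [Finset.mul_sum]
      exact Finset.sum_congr rfl fun c _ => by ring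
    rw [k1]
    simp only [add_mul, Finset.sum_add_distrib]
    rw [k2, k4]
    simp only [f3, f4]
    rw [k3]
    ring
  · have k1 : ∑ a, n a * (∑ b, γ a b * Dn b) = -n2 * ∑ b, Dn b * ℓ b := by
      simp only [Finset.mul_sum]
      rw [Finset.sum_comm]
      refine Finset.sum_congr rfl fun b _ => ?_
      have := congrArg (· * Dn b) (h.γn' b)
      simp only [Finset.sum_mul] at this
      rw [← Finset.sum_congr rfl fun a _ => mul_assoc (n a) (γ a b) (Dn b), this]
      ring
    have k3 : ∑ a, n a * (ℓ a * ((∑ f, n f * u f) - Dn2) + u a - n2 * φ a)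
        = (1 - n2 * ℓ2) * ((∑ f, n f * u f) - Dn2) + (∑ f, n f * u f)
          - n2 * ∑ f, n f * φ f := by
      rw [← h.nℓ, Finset.sum_mul, Finset.mul_sum, ← Finset.sum_add_distrib,
        ← Finset.sum_sub_distrib]
      exact Finset.sum_congr rfl fun c _ => by ring
    simp only [f3, f4] at k1
    rw [k3] at k1
    linarith

end SymBlocks

section MetricData

variable {U : Set (Fin m → ℝ)} {γ : Ten m} {ℓ : Vec m} {ℓ2 : Sc m} {P : Ten m}
  {n : Vec m} {n2 : Sc m}

lemma Gam0_symm (hU : IsOpen U) (h : MetricData U γ ℓ ℓ2 P n n2) {x : Fin m → ℝ} (hx : x ∈ U)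
    (c a b : Fin m) : Gam0 γ ℓ P n x c a b = Gam0 γ ℓ P n x c b a := by
  have e : ∀ d, pd d (fun y => γ y a b) x = pd d (fun y => γ y b a) x := fun d =>
    pd_congr hU hx (fun y hy => (symBlocks_of_metricData h hy).γs a b) d
  simp only [Gam0, e]
  congr 2
  · exact Finset.sum_congr rfl fun d _ => by ring
  · ring

lemma Uf_eq (hU : IsOpen U) (h : MetricData U γ ℓ ℓ2 P n n2) {x : Fin m → ℝ} (hx : x ∈ U)
    (a b : Fin m) :
    Uf γ ℓ n n2 x a b = -((∑ e, n x e * (pd a (fun y => γ y b e) x + pd b (fun y => γ y a e) x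
      - pd e (fun y => γ y a b) x))
      + n2 x * (pd a (fun y => ℓ y b) x + pd b (fun y => ℓ y a) x)) / 2 := by
  have hs := fun y hy => symBlocks_of_metricData (x := y) h hy
  obtain ⟨sγ, sℓ, -, -, sn, sn2, -, -, -⟩ := h
  have dγ := fun a b => differentiableAt_of_smooth hU (sγ a b) hx
  have dℓ := fun a => differentiableAt_of_smooth hU (sℓ a) hx
  have dn := fun a => differentiableAt_of_smooth hU (sn a) hx
  have dn2 := differentiableAt_of_smooth hU sn2 hx
  have key : ∀ a b, ∑ c, γ x b c * pd a (fun y => n y c) x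
      = -(∑ c, n x c * pd a (fun y => γ y b c) x) - pd a n2 x * ℓ x b
        - n2 x * pd a (fun y => ℓ y b) x := by
    intro a b
    have e := pd_congr hU hx (f := fun y => (∑ c, γ y b c * n y c) + n2 y * ℓ y b)
      (g := fun _ => 0) (fun y hy => by rw [(hs y hy).γn]; ring) a
    rw [pd_const, pd_add a (DifferentiableAt.fun_sum fun c _ => (dγ b c).fun_mul (dn c))
      (dn2.fun_mul (dℓ b)), pd_sum _ _ fun c => (dγ b c).fun_mul (dn c),
      pd_mul a dn2 (dℓ b),
      Finset.sum_congr rfl fun c _ => pd_mul a (dγ b c) (dn c), Finset.sum_add_distrib] at e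
    have e' : ∑ c, pd a (fun y => γ y b c) x * n x c = ∑ c, n x c * pd a (fun y => γ y b c) x :=
      Finset.sum_congr rfl fun c _ => mul_comm _ _
    linarith
  have e1 : ∑ c, γ x c b * pd a (fun y => n y c) x = ∑ c, γ x b c * pd a (fun y => n y c) x :=
    Finset.sum_congr rfl fun c _ => by rw [(hs x hx).γs]
  simp only [Uf, Finset.sum_add_distrib, Finset.sum_sub_distrib, mul_add, mul_sub, e1, key]
  ring

lemma covD1_ℓ (hU : IsOpen U) (h : MetricData U γ ℓ ℓ2 P n n2) {x : Fin m → ℝ} (hx : x ∈ U)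
    (a b : Fin m) :
    covD1 (Gam0 γ ℓ P n) ℓ x a b = Ff ℓ x a b - ℓ2 x * Uf γ ℓ n n2 x a b := by
  simp only [covD1, Gam0, (symBlocks_of_metricData h hx).conn_ℓ, Uf_eq hU h hx, Ff]
  ring

lemma covD2_γ (hU : IsOpen U) (h : MetricData U γ ℓ ℓ2 P n n2) {x : Fin m → ℝ} (hx : x ∈ U)
    (c a b : Fin m) :
    covD2 (Gam0 γ ℓ P n) γ x c a b
      = -(ℓ x a * Uf γ ℓ n n2 x c b) - ℓ x b * Uf γ ℓ n n2 x c a := by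
  have hs := symBlocks_of_metricData h hx
  have e : ∀ d a b, pd d (fun y => γ y a b) x = pd d (fun y => γ y b a) x := fun d a b =>
    pd_congr hU hx (fun y hy => (symBlocks_of_metricData h hy).γs a b) d
  have e1 : ∑ d, Gam0 γ ℓ P n x d c b * γ x a d = ∑ d, Gam0 γ ℓ P n x d c b * γ x d a :=
    Finset.sum_congr rfl fun d _ => by rw [hs.γs]
  rw [covD2, e1]
  simp only [Gam0, hs.conn_γ, Uf_eq hU h hx]
  rw [e c b a]
  ring

/-- Covariant derivatives of the inverse blocks with respect to the metric hypersurface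
connection. -/
lemma covD_inverse (hU : IsOpen U) (h : MetricData U γ ℓ ℓ2 P n n2) {x : Fin m → ℝ} (hx : x ∈ U)
    (c : Fin m) :
    (∀ a b, covD2U (Gam0 γ ℓ P n) P x c a b = -(n x a * ∑ f, P x b f * Ff ℓ x c f)
      - n x b * (∑ f, P x a f * Ff ℓ x c f) - n x a * n x b * pd c ℓ2 x) ∧
    (∀ a, covD1U (Gam0 γ ℓ P n) n x c a = (∑ f, P x a f * Uf γ ℓ n n2 x c f)
      - n2 x * (∑ f, P x a f * Ff ℓ x c f)
      - n x a * ((∑ f, n x f * Ff ℓ x c f) + n2 x * pd c ℓ2 x)) ∧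
    pd c n2 x = 2 * (∑ f, n x f * Uf γ ℓ n n2 x c f) - 2 * n2 x * (∑ f, n x f * Ff ℓ x c f)
      - n2 x * n2 x * pd c ℓ2 x ∧
    (∑ a, ℓ x a * covD1U (Gam0 γ ℓ P n) n x c a = -(∑ f, n x f * Ff ℓ x c f)
      + ℓ2 x * (∑ f, n x f * Uf γ ℓ n n2 x c f) - pd c n2 x * ℓ2 x - n2 x * pd c ℓ2 x) ∧
    (∀ a, ∑ b, γ x a b * covD1U (Gam0 γ ℓ P n) n x c b
      = ℓ x a * ((∑ f, n x f * Uf γ ℓ n n2 x c f) - pd c n2 x) + Uf γ ℓ n n2 x c a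
        - n2 x * Ff ℓ x c a) := by
  have hs := fun y hy => symBlocks_of_metricData (x := y) h hy
  have hDγ := covD2_γ hU h hx
  have hDℓ := covD1_ℓ hU h hx
  obtain ⟨sγ, sℓ, sℓ2, sP, sn, sn2, -, -, -⟩ := h
  have dγ := fun a b => differentiableAt_of_smooth hU (sγ a b) hx
  have dℓ := fun a => differentiableAt_of_smooth hU (sℓ a) hx
  have dP := fun a b => differentiableAt_of_smooth hU (sP a b) hx
  have dn := fun a => differentiableAt_of_smooth hU (sn a) hx
  have dn2 := differentiableAt_of_smooth hU sn2 hx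
  have dℓ2 := differentiableAt_of_smooth hU sℓ2 hx
  have dneg : ∀ {f : Sc m}, DifferentiableAt ℝ f x → DifferentiableAt ℝ (fun y => -f y) x :=
    fun hf => hf.fun_neg
  have pneg : ∀ {f : Sc m}, pd c (fun y => -f y) x = -pd c f x := fun {f} => by
    simp [pd, fderiv_fun_neg]
  set Γ := Gam0 γ ℓ P n with hΓ
  refine (hs x hx).deriv_inverse ?_ ?_ ?_ ?_
  · intro a b
    have e := pd_congr hU hx (f := fun y => (∑ e, P y a e * γ y e b) + n y a * ℓ y b)
      (g := fun _ => kd a b) (fun y hy => by rw [(hs y hy).Pγ]; ring) c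
    rw [pd_const, pd_add c (DifferentiableAt.fun_sum fun e _ => (dP a e).fun_mul (dγ e b))
      ((dn a).fun_mul (dℓ b)), pd_sum _ _ fun e => (dP a e).fun_mul (dγ e b),
      pd_mul c (dn a) (dℓ b),
      Finset.sum_congr rfl fun e _ => pd_mul c (dP a e) (dγ e b), Finset.sum_add_distrib] at e
    have k1 : ∑ f, Γ x a c f * ((∑ e, P x f e * γ x e b) + n x f * ℓ x b) = Γ x a c b := by
      simp only [(hs x hx).Pγ, sub_add_cancel, sum_mul_kd]
    have k2 : ∑ f, Γ x f c b * ((∑ e, P x a e * γ x e f) + n x a * ℓ x f) = Γ x a c b := by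
      simp only [(hs x hx).Pγ, sub_add_cancel, kd_comm a, sum_mul_kd]
    have k3 : ∑ e, ∑ f, Γ x a c f * P x f e * γ x e b
        = ∑ f, ∑ e, Γ x a c f * (P x f e * γ x e b) := by
      rw [Finset.sum_comm]
      exact Finset.sum_congr rfl fun e _ => Finset.sum_congr rfl fun f _ => by ring
    have k4 : ∑ e, ∑ f, P x a e * (Γ x f c b * γ x e f)
        = ∑ f, ∑ e, Γ x f c b * (P x a e * γ x e f) := by
      rw [Finset.sum_comm]
      exact Finset.sum_congr rfl fun e _ => Finset.sum_congr rfl fun f _ => by ring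
    have k5 : ∑ e, ∑ f, Γ x e c f * P x a f * γ x e b
        = ∑ e, ∑ f, P x a e * (Γ x f c e * γ x f b) := by
      rw [Finset.sum_comm]
      exact Finset.sum_congr rfl fun e _ => Finset.sum_congr rfl fun f _ => by ring
    have k6 : ∑ f, Γ x a c f * (n x f * ℓ x b) = ∑ f, Γ x a c f * n x f * ℓ x b :=
      Finset.sum_congr rfl fun f _ => by ring
    have k7 : ∑ f, Γ x f c b * (n x a * ℓ x f) = ∑ f, n x a * (Γ x f c b * ℓ x f) :=
      Finset.sum_congr rfl fun f _ => by ring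
    simp only [← hDγ, ← hDℓ]
    simp only [mul_add, Finset.mul_sum, Finset.sum_add_distrib] at k1 k2
    simp only [covD2U, covD2, covD1U, covD1, add_mul, mul_sub, Finset.mul_sum, Finset.sum_mul,
      Finset.sum_add_distrib, Finset.sum_sub_distrib]
    linarith
  · intro a
    have e := pd_congr hU hx (f := fun y => ∑ b, P y b a * ℓ y b)
      (g := fun y => -(ℓ2 y * n y a)) (fun y hy => (hs y hy).Pℓ' a) c
    have e' := covD1U_contract Γ dP dℓ c a
    have k : ∑ f, Γ x a c f * ∑ b, P x b f * ℓ x b = -(ℓ2 x * ∑ f, Γ x a c f * n x f) := by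
      simp only [(hs x hx).Pℓ', Finset.mul_sum, ← Finset.sum_neg_distrib]
      exact Finset.sum_congr rfl fun f _ => by ring
    rw [covD1U, e, pneg, pd_mul c dℓ2 (dn a), k] at e'
    have s1 : ∀ b, covD2U Γ P x c b a = covD2U Γ P x c a b := by
      intro b
      have r1 : ∑ d, Γ x b c d * P x d a = ∑ d, Γ x b c d * P x a d :=
        Finset.sum_congr rfl fun d _ => by rw [(hs x hx).Ps]
      have r2 : ∑ d, Γ x a c d * P x b d = ∑ d, Γ x a c d * P x d b :=
        Finset.sum_congr rfl fun d _ => by rw [(hs x hx).Ps]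
      simp only [covD2U, pd_congr hU hx (fun y hy => (hs y hy).Ps b a) c, r1, r2]
      ring
    have e2 : ∑ b, (covD2U Γ P x c b a * ℓ x b + P x b a * covD1 Γ ℓ x c b)
        = ∑ b, (covD2U Γ P x c a b * ℓ x b + P x a b * covD1 Γ ℓ x c b) :=
      Finset.sum_congr rfl fun b _ => by rw [s1, (hs x hx).Ps]
    simp only [← hDℓ]
    rw [← e2, ← e']
    simp only [covD1U]
    ring
  · have e := pd_congr hU hx (f := fun y => (∑ a, n y a * ℓ y a) + n2 y * ℓ2 y)
      (g := fun _ => 1) (fun y hy => by rw [(hs y hy).nℓ]; ring) c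
    rw [pd_const, pd_add c (DifferentiableAt.fun_sum fun a _ => (dn a).fun_mul (dℓ a))
      (dn2.fun_mul dℓ2), pd_contract1 Γ dn dℓ c, pd_mul c dn2 dℓ2] at e
    simp only [← hDℓ]
    linarith
  · intro a
    have e := pd_congr hU hx (f := fun y => ∑ b, γ y a b * n y b)
      (g := fun y => -(n2 y * ℓ y a)) (fun y hy => (hs y hy).γn a) c
    have e' := covD1_contract Γ dγ dn c a
    have k : ∑ f, Γ x f c a * ∑ b, γ x f b * n x b = -(n2 x * ∑ f, Γ x f c a * ℓ x f) := by
      simp only [(hs x hx).γn, Finset.mul_sum, ← Finset.sum_neg_distrib]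
      exact Finset.sum_congr rfl fun f _ => by ring
    rw [covD1, e, pneg, pd_mul c dn2 (dℓ a), k] at e'
    simp only [← hDγ, ← hDℓ]
    rw [← e']
    simp only [covD1]
    ring

/-! ### The Gauss-Codazzi quantities in terms of the metric hypersurface connection -/

lemma curv_sub (Γ : Conn m) {n : Vec m} {Y : Ten m} {x : Fin m → ℝ}
    (dΓ : ∀ a b c, DifferentiableAt ℝ (fun y => Γ y a b c) x)
    (dn : ∀ a, DifferentiableAt ℝ (fun y => n y a) x)
    (dY : ∀ a b, DifferentiableAt ℝ (fun y => Y y a b) x)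
    (hΓ : ∀ a b c, Γ x a b c = Γ x a c b) (a b c d : Fin m) :
    curv (fun y a b c => Γ y a b c - n y a * Y y b c) x a b c d
      = curv Γ x a b c d - covD1U Γ n x c a * Y x d b + covD1U Γ n x d a * Y x c b
        + n x a * (covD2 Γ Y x d c b - covD2 Γ Y x c d b
          + (∑ f, n x f * Y x c f) * Y x d b - (∑ f, n x f * Y x d f) * Y x c b) := by
  have hp : ∀ c d, pd c (fun y => Γ y a d b - n y a * Y y d b) x
      = pd c (fun y => Γ y a d b) x - (pd c (fun y => n y a) x * Y x d b
        + n x a * pd c (fun y => Y y d b) x) := fun c d => by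
    rw [pd_sub c (dΓ a d b) ((dn a).fun_mul (dY d b)), pd_mul c (dn a) (dY d b)]
  have hs : ∀ c d, ∑ f, (Γ x a c f - n x a * Y x c f) * (Γ x f d b - n x f * Y x d b)
      = (∑ f, Γ x a c f * Γ x f d b) - (∑ f, Γ x a c f * n x f) * Y x d b
        - n x a * (∑ f, Γ x f d b * Y x c f) + n x a * (∑ f, n x f * Y x c f) * Y x d b := by
    intro c d
    simp only [Finset.sum_mul, Finset.mul_sum, ← Finset.sum_sub_distrib,
      ← Finset.sum_add_distrib]
    exact Finset.sum_congr rfl fun f _ => by ring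
  have hc : ∑ f, Γ x f d c * Y x f b = ∑ f, Γ x f c d * Y x f b :=
    Finset.sum_congr rfl fun f _ => by rw [hΓ]
  simp only [curv, covD1U, covD2, hp, hs, hc]
  ring

lemma covD2_sub (Γ : Conn m) (n : Vec m) (Y K : Ten m) (x : Fin m → ℝ) (a b c : Fin m) :
    covD2 (fun y a b c => Γ y a b c - n y a * Y y b c) K x a b c
      = covD2 Γ K x a b c + Y x a b * (∑ f, n x f * K x f c)
        + Y x a c * (∑ f, n x f * K x b f) := by
  have e1 : ∀ b (v : Fin m → ℝ), ∑ f, (Γ x f a b - n x f * Y x a b) * v f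
      = (∑ f, Γ x f a b * v f) - Y x a b * ∑ f, n x f * v f := by
    intro b v
    simp only [Finset.mul_sum, ← Finset.sum_sub_distrib]
    exact Finset.sum_congr rfl fun f _ => by ring
  simp only [covD2, e1 b fun f => K x f c, e1 c fun f => K x b f]
  ring

lemma covD1_sub (Γ : Conn m) (n : Vec m) (Y : Ten m) (ω : Vec m) (x : Fin m → ℝ)
    (a b : Fin m) :
    covD1 (fun y a b c => Γ y a b c - n y a * Y y b c) ω x a b
      = covD1 Γ ω x a b + Y x a b * ∑ f, n x f * ω x f := by
  have e1 : ∑ f, (Γ x f a b - n x f * Y x a b) * ω x f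
      = (∑ f, Γ x f a b * ω x f) - Y x a b * ∑ f, n x f * ω x f := by
    simp only [Finset.mul_sum, ← Finset.sum_sub_distrib]
    exact Finset.sum_congr rfl fun f _ => by ring
  simp only [covD1, e1]
  ring

lemma covD2_smul_add (Γ : Conn m) {T S : Ten m} {s : Sc m} {x : Fin m → ℝ}
    (hs : DifferentiableAt ℝ s x) (hT : ∀ a b, DifferentiableAt ℝ (fun y => T y a b) x)
    (hS : ∀ a b, DifferentiableAt ℝ (fun y => S y a b) x) (a b c : Fin m) :
    covD2 Γ (fun y b c => s y * T y b c + S y b c) x a b c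
      = pd a s x * T x b c + s x * covD2 Γ T x a b c + covD2 Γ S x a b c := by
  have hp : pd a (fun y => s y * T y b c + S y b c) x
      = pd a s x * T x b c + s x * pd a (fun y => T y b c) x + pd a (fun y => S y b c) x := by
    rw [pd_add a (hs.fun_mul (hT b c)) (hS b c), pd_mul a hs (hT b c)]
  have e1 : ∀ v w g : Fin m → ℝ, ∑ f, g f * (s x * v f + w f)
      = s x * (∑ f, g f * v f) + ∑ f, g f * w f := by
    intro v w g
    simp only [Finset.mul_sum, ← Finset.sum_add_distrib]
    exact Finset.sum_congr rfl fun f _ => by ring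
  simp only [covD2, hp, e1 (fun f => T x f c) (fun f => S x f c),
    e1 (fun f => T x b f) (fun f => S x b f)]
  ring

lemma Ff_antisymm (ℓ : Vec m) (x : Fin m → ℝ) (a b : Fin m) : Ff ℓ x a b = -Ff ℓ x b a := by
  simp only [Ff]
  ring

lemma Uf_symm (hU : IsOpen U) (h : MetricData U γ ℓ ℓ2 P n n2) {x : Fin m → ℝ} (hx : x ∈ U)
    (a b : Fin m) : Uf γ ℓ n n2 x a b = Uf γ ℓ n n2 x b a := by
  have e : ∀ d, pd d (fun y => γ y a b) x = pd d (fun y => γ y b a) x := fun d =>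
    pd_congr hU hx (fun y hy => (symBlocks_of_metricData h hy).γs a b) d
  rw [Uf_eq hU h hx, Uf_eq hU h hx]
  simp only [e, add_comm]

variable {Y : Ten m}

lemma covD2_Kf (hU : IsOpen U) (h : MetricData U γ ℓ ℓ2 P n n2) (hYsm : SmTen U Y)
    (hYs : ∀ x ∈ U, ∀ a b, Y x a b = Y x b a) {x : Fin m → ℝ} (hx : x ∈ U) (d b c : Fin m) :
    covD2 (GamB γ ℓ P n Y) (Kf γ ℓ n n2 Y) x d b c
      = pd d n2 x * Y x b c + n2 x * covD2 (Gam0 γ ℓ P n) Y x d b c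
        + covD2 (Gam0 γ ℓ P n) (Uf γ ℓ n n2) x d b c
        + Y x d b * (n2 x * (∑ f, n x f * Y x c f) + ∑ f, n x f * Uf γ ℓ n n2 x c f)
        + Y x d c * (n2 x * (∑ f, n x f * Y x b f) + ∑ f, n x f * Uf γ ℓ n n2 x b f) := by
  have hUs := Uf_symm hU h hx
  obtain ⟨sγ, sℓ, sℓ2, sP, sn, sn2, -, -, -⟩ := h
  have e := covD2_sub (Gam0 γ ℓ P n) n Y (Kf γ ℓ n n2 Y) x d b c
  have e' := covD2_smul_add (Gam0 γ ℓ P n) (differentiableAt_of_smooth hU sn2 hx)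
    (fun a b => differentiableAt_of_smooth hU (hYsm a b) hx)
    (differentiableAt_Uf hU sγ sℓ sn sn2 hx) d b c
  have k : ∀ c, ∑ f, n x f * Kf γ ℓ n n2 Y x c f
      = n2 x * (∑ f, n x f * Y x c f) + ∑ f, n x f * Uf γ ℓ n n2 x c f := by
    intro c
    simp only [Kf, Finset.mul_sum, ← Finset.sum_add_distrib]
    exact Finset.sum_congr rfl fun f _ => by ring
  have k' : ∑ f, n x f * Kf γ ℓ n n2 Y x f c = ∑ f, n x f * Kf γ ℓ n n2 Y x c f :=
    Finset.sum_congr rfl fun f _ => by simp only [Kf, hYs x hx f c, hUs f c]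
  rw [k', k, k] at e
  change covD2 (GamB γ ℓ P n Y) (Kf γ ℓ n n2 Y) x d b c = _ at e
  change covD2 (Gam0 γ ℓ P n) (Kf γ ℓ n n2 Y) x d b c = _ at e'
  rw [e, e']

lemma sum_mul_curv_GamB (hU : IsOpen U) (h : MetricData U γ ℓ ℓ2 P n n2) (hYsm : SmTen U Y)
    (hYs : ∀ x ∈ U, ∀ a b, Y x a b = Y x b a) {x : Fin m → ℝ} (hx : x ∈ U)
    (w : Fin m → ℝ) (b c d : Fin m) :
    ∑ a, w a * curv (GamB γ ℓ P n Y) x a b c d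
      = (∑ a, w a * curv (Gam0 γ ℓ P n) x a b c d)
        - (∑ a, w a * covD1U (Gam0 γ ℓ P n) n x c a) * Y x b d
        + (∑ a, w a * covD1U (Gam0 γ ℓ P n) n x d a) * Y x b c
        + (∑ a, w a * n x a) * (covD2 (Gam0 γ ℓ P n) Y x d b c
          - covD2 (Gam0 γ ℓ P n) Y x c b d
          + (∑ f, n x f * Y x c f) * Y x b d - (∑ f, n x f * Y x d f) * Y x b c) := by
  have hΓ := Gam0_symm hU h hx
  obtain ⟨sγ, sℓ, sℓ2, sP, sn, sn2, -, -, -⟩ := h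
  have e : ∀ a, curv (GamB γ ℓ P n Y) x a b c d = _ := fun a =>
    curv_sub (Gam0 γ ℓ P n) (differentiableAt_Gam0 hU sγ sℓ sP sn hx)
      (fun a => differentiableAt_of_smooth hU (sn a) hx)
      (fun a b => differentiableAt_of_smooth hU (hYsm a b) hx) hΓ a b c d
  simp only [e, Finset.sum_mul, ← Finset.sum_sub_distrib, ← Finset.sum_add_distrib]
  refine Finset.sum_congr rfl fun a _ => ?_
  rw [covD2_symm hU _ hYs hx d b c, covD2_symm hU _ hYs hx c b d, hYs x hx b c, hYs x hx b d]
  ring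

lemma Idef_eq (hU : IsOpen U) (h : MetricData U γ ℓ ℓ2 P n n2) (hYsm : SmTen U Y)
    (hYs : ∀ x ∈ U, ∀ a b, Y x a b = Y x b a) {x : Fin m → ℝ} (hx : x ∈ U) (b c d : Fin m) :
    Idef γ ℓ ℓ2 P n n2 Y x b c d
      = (∑ a, ℓ x a * curv (Gam0 γ ℓ P n) x a b c d)
      + (covD2 (Gam0 γ ℓ P n) Y x d b c
        - Y x b c * ((∑ f, n x f * Y x d f) + (∑ f, n x f * Ff ℓ x d f)
          + n2 x * pd d ℓ2 x / 2)
        + Uf γ ℓ n n2 x b c * pd d ℓ2 x / 2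
        + ℓ2 x * covD2 (Gam0 γ ℓ P n) (Uf γ ℓ n n2) x d b c)
      - (covD2 (Gam0 γ ℓ P n) Y x c b d
        - Y x b d * ((∑ f, n x f * Y x c f) + (∑ f, n x f * Ff ℓ x c f)
          + n2 x * pd c ℓ2 x / 2)
        + Uf γ ℓ n n2 x b d * pd c ℓ2 x / 2
        + ℓ2 x * covD2 (Gam0 γ ℓ P n) (Uf γ ℓ n n2) x c b d) := by
  obtain ⟨-, -, hc2, hc3, -⟩ := covD_inverse hU h hx c
  obtain ⟨-, -, hd2, hd3, -⟩ := covD_inverse hU h hx d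
  have hn : ∑ a, ℓ x a * n x a = 1 - n2 x * ℓ2 x := by
    rw [← (symBlocks_of_metricData h hx).nℓ]
    exact Finset.sum_congr rfl fun _ _ => mul_comm _ _
  rw [Idef, sum_mul_curv_GamB hU h hYsm hYs hx, covD2_Kf hU h hYsm hYs hx,
    covD2_Kf hU h hYsm hYs hx, hn, hc3, hd3, hc2, hd2, hYs x hx d b, hYs x hx c b,
    hYs x hx d c, Kf, Kf]
  ring

lemma IIdef_eq (hU : IsOpen U) (h : MetricData U γ ℓ ℓ2 P n n2) (hYsm : SmTen U Y)
    (hYs : ∀ x ∈ U, ∀ a b, Y x a b = Y x b a) {x : Fin m → ℝ} (hx : x ∈ U)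
    (a b c d : Fin m) :
    IIdef γ ℓ ℓ2 P n n2 Y x a b c d
      = (∑ f, γ x a f * curv (Gam0 γ ℓ P n) x f b c d)
      + (Y x b c * Uf γ ℓ n n2 x d a + n2 x * Y x b c * Y x d a
        + Uf γ ℓ n n2 x b c * (Ff ℓ x d a + Y x d a)
        + ℓ x a * covD2 (Gam0 γ ℓ P n) (Uf γ ℓ n n2) x d b c)
      - (Y x b d * Uf γ ℓ n n2 x c a + n2 x * Y x b d * Y x c a
        + Uf γ ℓ n n2 x b d * (Ff ℓ x c a + Y x c a)
        + ℓ x a * covD2 (Gam0 γ ℓ P n) (Uf γ ℓ n n2) x c b d) := by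
  obtain ⟨-, -, hc2, -, hc3⟩ := covD_inverse hU h hx c
  obtain ⟨-, -, hd2, -, hd3⟩ := covD_inverse hU h hx d
  have hs := symBlocks_of_metricData h hx
  have e : ∀ c, covD1 (GamB γ ℓ P n Y) ℓ x c a = _ := fun c =>
    covD1_sub (Gam0 γ ℓ P n) n Y ℓ x c a
  rw [IIdef, sum_mul_curv_GamB hU h hYsm hYs hx, covD2_Kf hU h hYsm hYs hx,
    covD2_Kf hU h hYsm hYs hx, e, e, covD1_ℓ hU h hx, covD1_ℓ hU h hx, hs.γn, hs.nℓ,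
    hc3, hd3, hc2, hd2, hYs x hx d b, hYs x hx c b, hYs x hx d c, Kf, Kf, Kf, Kf]
  ring

lemma covD11_contract (Γ : Conn m) {T Y : Ten m} {x : Fin m → ℝ}
    (hT : ∀ a b, DifferentiableAt ℝ (fun y => T y a b) x)
    (hY : ∀ a b, DifferentiableAt ℝ (fun y => Y y a b) x) (a d c : Fin m) :
    covD11 Γ (fun y d' c' => ∑ b, T y b d' * Y y b c') x a d c
      = ∑ b, (covD2U Γ T x a b d * Y x b c + T x b d * covD2 Γ Y x a b c) := by
  have hp : pd a (fun y => ∑ b, T y b d * Y y b c) x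
      = ∑ b, (pd a (fun y => T y b d) x * Y x b c + T x b d * pd a (fun y => Y y b c) x) := by
    rw [pd_sum _ _ fun b => (hT b d).fun_mul (hY b c)]
    exact Finset.sum_congr rfl fun b _ => pd_mul a (hT b d) (hY b c)
  have h1 : ∑ b, ∑ f, Γ x b a f * T x f d * Y x b c
      = ∑ b, ∑ f, T x b d * (Γ x f a b * Y x f c) := by
    rw [Finset.sum_comm]
    exact Finset.sum_congr rfl fun b _ => Finset.sum_congr rfl fun f _ => by ring
  have h2 : ∑ f, ∑ b, Γ x d a f * (T x b f * Y x b c)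
      = ∑ b, ∑ f, Γ x d a f * T x b f * Y x b c := by
    rw [Finset.sum_comm]
    exact Finset.sum_congr rfl fun b _ => Finset.sum_congr rfl fun f _ => by ring
  have h3 : ∑ f, ∑ b, Γ x f a c * (T x b d * Y x b f)
      = ∑ b, ∑ f, T x b d * (Γ x f a c * Y x b f) := by
    rw [Finset.sum_comm]
    exact Finset.sum_congr rfl fun b _ => Finset.sum_congr rfl fun f _ => by ring
  simp only [covD11, covD2U, covD2, hp, add_mul, mul_sub, Finset.mul_sum, Finset.sum_mul,
    Finset.sum_add_distrib, Finset.sum_sub_distrib]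
  linarith

lemma covD11_sub_kd (Γ : Conn m) {S : Ten m} {s : Sc m} {x : Fin m → ℝ}
    (hS : ∀ a b, DifferentiableAt ℝ (fun y => S y a b) x) (hs : DifferentiableAt ℝ s x)
    (a d c : Fin m) :
    covD11 Γ (fun y d' c' => S y d' c' - kd d' c' * s y) x a d c
      = covD11 Γ S x a d c - kd d c * pd a s x := by
  have hp : pd a (fun y => S y d c - kd d c * s y) x
      = pd a (fun y => S y d c) x - kd d c * pd a s x := by
    rw [pd_sub a (hS d c) (hs.const_mul _), pd_mul a (differentiableAt_const _) hs, pd_const]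
    ring
  have h1 : ∑ f, Γ x d a f * (kd f c * s x) = Γ x d a c * s x := by
    rw [← sum_mul_kd (fun f => Γ x d a f * s x) c]
    exact Finset.sum_congr rfl fun f _ => by ring
  have h2 : ∑ f, Γ x f a c * (kd d f * s x) = Γ x d a c * s x := by
    rw [← sum_kd_mul (fun f => Γ x f a c * s x) d]
    exact Finset.sum_congr rfl fun f _ => by ring
  simp only [covD11, hp, mul_sub, Finset.sum_sub_distrib, h1, h2]
  ring

lemma covD2U_smul_sub_mul (Γ : Conn m) {P : Ten m} {n : Vec m} {s : Sc m} {x : Fin m → ℝ}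
    (hP : ∀ a b, DifferentiableAt ℝ (fun y => P y a b) x)
    (hn : ∀ a, DifferentiableAt ℝ (fun y => n y a) x) (hs : DifferentiableAt ℝ s x)
    (a b d : Fin m) :
    covD2U Γ (fun y b d => s y * P y b d - n y b * n y d) x a b d
      = pd a s x * P x b d + s x * covD2U Γ P x a b d - covD1U Γ n x a b * n x d
        - n x b * covD1U Γ n x a d := by
  have hp : pd a (fun y => s y * P y b d - n y b * n y d) x
      = pd a s x * P x b d + s x * pd a (fun y => P y b d) x
        - (pd a (fun y => n y b) x * n x d + n x b * pd a (fun y => n y d) x) := by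
    rw [pd_sub a (hs.fun_mul (hP b d)) ((hn b).fun_mul (hn d)), pd_mul a hs (hP b d),
      pd_mul a (hn b) (hn d)]
  have e1 : ∑ f, Γ x b a f * (s x * P x f d - n x f * n x d)
      = s x * (∑ f, Γ x b a f * P x f d) - (∑ f, Γ x b a f * n x f) * n x d := by
    simp only [Finset.mul_sum, Finset.sum_mul, ← Finset.sum_sub_distrib]
    exact Finset.sum_congr rfl fun f _ => by ring
  have e2 : ∑ f, Γ x d a f * (s x * P x b f - n x b * n x f)
      = s x * (∑ f, Γ x d a f * P x b f) - (∑ f, Γ x d a f * n x f) * n x b := by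
    simp only [Finset.mul_sum, Finset.sum_mul, ← Finset.sum_sub_distrib]
    exact Finset.sum_congr rfl fun f _ => by ring
  simp only [covD2U, covD1U, hp, e1, e2]
  ring

/-! ### Divergences -/

lemma divergence_vector (Γ : Conn m) {P Y : Ten m} {n : Vec m} {x : Fin m → ℝ}
    (dP : ∀ a b, DifferentiableAt ℝ (fun y => P y a b) x)
    (dn : ∀ a, DifferentiableAt ℝ (fun y => n y a) x)
    (dY : ∀ a b, DifferentiableAt ℝ (fun y => Y y a b) x) :
    ∑ d, covD1U Γ (fun y d' => ∑ b, ∑ c, (P y b d' * n y c - P y b c * n y d') * Y y b c) x d d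
      = (∑ b, ∑ c, ∑ d, (P x b d * n x c - P x b c * n x d) * covD2 Γ Y x d b c)
        + ∑ b, ∑ c, Y x b c * ((∑ d, covD2U Γ P x d b d) * n x c
          + (∑ d, P x b d * covD1U Γ n x d c) - (∑ d, n x d * covD2U Γ P x d b c)
          - P x b c * ∑ d, covD1U Γ n x d d) := by
  have hV : (fun (y : Fin m → ℝ) d' =>
        ∑ b, ∑ c, (P y b d' * n y c - P y b c * n y d') * Y y b c)
      = fun y d' => (∑ b, P y b d' * ∑ c, Y y b c * n y c)
        - (∑ b, ∑ c, P y b c * Y y b c) * n y d' := by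
    funext y d'
    simp only [Finset.mul_sum, Finset.sum_mul, ← Finset.sum_sub_distrib]
    exact Finset.sum_congr rfl fun b _ => Finset.sum_congr rfl fun c _ => by ring
  have dYn : ∀ b, DifferentiableAt ℝ (fun y => ∑ c, Y y b c * n y c) x := fun b =>
    DifferentiableAt.fun_sum fun c _ => (dY b c).fun_mul (dn c)
  have ds : DifferentiableAt ℝ (fun y => ∑ b, ∑ c, P y b c * Y y b c) x :=
    DifferentiableAt.fun_sum fun b _ => DifferentiableAt.fun_sum fun c _ =>
      (dP b c).fun_mul (dY b c)
  have dPYn : ∀ d, DifferentiableAt ℝ (fun y => ∑ b, P y b d * ∑ c, Y y b c * n y c) x :=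
    fun d => DifferentiableAt.fun_sum fun b _ => (dP b d).fun_mul (dYn b)
  rw [hV]
  simp only [covD1U_sub_smul Γ dPYn ds dn, covD1U_contract Γ dP dYn, covD1_contract Γ dY dn,
    pd_contract2 Γ dP dY]
  have r : ∀ g : Fin m → Fin m → Fin m → ℝ,
      ∑ d, ∑ b, ∑ c, g d b c = ∑ b, ∑ c, ∑ d, g d b c := by
    intro g
    rw [Finset.sum_comm]
    exact Finset.sum_congr rfl fun b _ => Finset.sum_comm
  simp only [Finset.mul_sum, Finset.sum_mul, ← Finset.sum_sub_distrib, ← Finset.sum_add_distrib]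
  rw [r]
  exact Finset.sum_congr rfl fun b _ => Finset.sum_congr rfl fun c _ =>
    Finset.sum_congr rfl fun d _ => by ring

lemma divergence_covector (Γ : Conn m) {W Y : Ten m} {x : Fin m → ℝ}
    (dW : ∀ a b, DifferentiableAt ℝ (fun y => W y a b) x)
    (dY : ∀ a b, DifferentiableAt ℝ (fun y => Y y a b) x) (c : Fin m) :
    ∑ f, covD11 Γ (fun y f' c' => ∑ b, ∑ d, W y b d
        * (kd f' d * Y y b c' - kd f' c' * Y y b d)) x f f c
      = (∑ b, ∑ d, W x b d * (covD2 Γ Y x d b c - covD2 Γ Y x c b d))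
        + (∑ b, (∑ d, covD2U Γ W x d b d) * Y x b c)
        - ∑ b, ∑ d, covD2U Γ W x c b d * Y x b d := by
  have hV : (fun (y : Fin m → ℝ) f' c' => ∑ b, ∑ d, W y b d
        * (kd f' d * Y y b c' - kd f' c' * Y y b d))
      = fun y f' c' => (∑ b, W y b f' * Y y b c')
        - kd f' c' * ∑ b, ∑ d, W y b d * Y y b d := by
    funext y f' c'
    simp only [mul_sub, Finset.sum_sub_distrib]
    congr 1
    · refine Finset.sum_congr rfl fun b _ => ?_
      rw [← sum_kd_mul (fun d => W y b d * Y y b c') f']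
      exact Finset.sum_congr rfl fun d _ => by ring
    · simp only [Finset.mul_sum]
      exact Finset.sum_congr rfl fun b _ => Finset.sum_congr rfl fun d _ => by ring
  have ds : DifferentiableAt ℝ (fun y => ∑ b, ∑ d, W y b d * Y y b d) x :=
    DifferentiableAt.fun_sum fun b _ => DifferentiableAt.fun_sum fun c _ =>
      (dW b c).fun_mul (dY b c)
  have dS : ∀ f c, DifferentiableAt ℝ (fun y => ∑ b, W y b f * Y y b c) x := fun f c =>
    DifferentiableAt.fun_sum fun b _ => (dW b f).fun_mul (dY b c)
  have hk : ∑ f, kd f c * pd f (fun y => ∑ b, ∑ d, W y b d * Y y b d) x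
      = pd c (fun y => ∑ b, ∑ d, W y b d * Y y b d) x := by
    rw [← sum_mul_kd (fun f => pd f (fun y => ∑ b, ∑ d, W y b d * Y y b d) x) c]
    exact Finset.sum_congr rfl fun f _ => mul_comm _ _
  rw [hV]
  simp only [covD11_sub_kd Γ dS ds, Finset.sum_sub_distrib, hk]
  simp only [covD11_contract Γ dW dY, pd_contract2 Γ dW dY]
  rw [Finset.sum_comm]
  simp only [Finset.sum_mul, ← Finset.sum_sub_distrib, ← Finset.sum_add_distrib]
  exact Finset.sum_congr rfl fun b _ => Finset.sum_congr rfl fun d _ => by ring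

/-! ### Contraction identities -/

lemma sum3_rotate (g : Fin m → Fin m → Fin m → ℝ) :
    ∑ d, ∑ b, ∑ c, g d b c = ∑ b, ∑ c, ∑ d, g d b c := by
  rw [Finset.sum_comm]
  exact Finset.sum_congr rfl fun b _ => Finset.sum_comm

lemma sum4_rotate (g : Fin m → Fin m → Fin m → Fin m → ℝ) :
    ∑ a, ∑ b, ∑ c, ∑ d, g b c d a = ∑ a, ∑ b, ∑ c, ∑ d, g a b c d := by
  rw [sum3_rotate fun a b c => ∑ d, g b c d a]
  exact Finset.sum_congr rfl fun a _ => Finset.sum_congr rfl fun b _ => Finset.sum_comm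

lemma sum4_reverse (g : Fin m → Fin m → Fin m → Fin m → ℝ) :
    ∑ a, ∑ b, ∑ c, ∑ d, g d c b a = ∑ a, ∑ b, ∑ c, ∑ d, g a b c d := by
  rw [sum4_rotate fun a b c d => g c b a d, ← sum3_rotate fun c a b => ∑ d, g c b a d]
  exact Finset.sum_congr rfl fun a _ => Finset.sum_comm

/-- The double trace, with the trace-reversal structure of the Gauss equation, of a product of
two covariant two-tensors. -/
lemma gauss_pair_eq {P A C : Fin m → Fin m → ℝ} (Ps : ∀ a b, P a b = P b a) :
    ∑ a, ∑ b, ∑ c, ∑ d, A b c * C d a * (P a c * P b d - P a d * P b c)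
      = ∑ b, ∑ c, A b c * ((∑ d, P b d * ∑ a, P c a * C d a)
        - P b c * ∑ d, ∑ a, P d a * C d a) := by
  rw [sum3_rotate fun a b c => ∑ d, A b c * C d a * (P a c * P b d - P a d * P b c)]
  refine Finset.sum_congr rfl fun b _ => Finset.sum_congr rfl fun c _ => ?_
  rw [Finset.sum_comm]
  simp only [Finset.mul_sum, ← Finset.sum_sub_distrib]
  refine Finset.sum_congr rfl fun d _ => Finset.sum_congr rfl fun a _ => ?_
  rw [Ps a c, Ps a d]
  ring

lemma gauss_pair_comm {P A C : Fin m → Fin m → ℝ} (Ps : ∀ a b, P a b = P b a) :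
    ∑ a, ∑ b, ∑ c, ∑ d, A b c * C d a * (P a c * P b d - P a d * P b c)
      = ∑ a, ∑ b, ∑ c, ∑ d, C b c * A d a * (P a c * P b d - P a d * P b c) := by
  rw [← sum4_rotate fun a b c d => A b c * C d a * (P a c * P b d - P a d * P b c),
    ← sum4_rotate fun a b c d => A c d * C a b * (P b d * P c a - P b a * P c d)]
  refine Finset.sum_congr rfl fun a _ => Finset.sum_congr rfl fun b _ =>
    Finset.sum_congr rfl fun c _ => Finset.sum_congr rfl fun d _ => ?_
  rw [Ps c a, Ps d b, Ps c b, Ps d a]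
  ring

lemma gauss_pair_eq_zero {P A C : Fin m → Fin m → ℝ} (Ps : ∀ a b, P a b = P b a)
    (As : ∀ a b, A a b = A b a) (Ca : ∀ a b, C a b = -C b a) :
    ∑ a, ∑ b, ∑ c, ∑ d, A b c * C d a * (P a c * P b d - P a d * P b c) = 0 := by
  have e : ∑ a, ∑ b, ∑ c, ∑ d, A b c * C d a * (P a c * P b d - P a d * P b c)
      = -∑ a, ∑ b, ∑ c, ∑ d, A b c * C d a * (P a c * P b d - P a d * P b c) := by
    conv_lhs => rw [← sum4_reverse]
    simp only [← Finset.sum_neg_distrib]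
    refine Finset.sum_congr rfl fun a _ => Finset.sum_congr rfl fun b _ =>
      Finset.sum_congr rfl fun c _ => Finset.sum_congr rfl fun d _ => ?_
    rw [As c b, Ca a d, Ps d b, Ps c a, Ps d a, Ps c b]
    ring
  linarith

lemma gauss_pair_self {P A : Fin m → Fin m → ℝ} :
    ∑ a, ∑ b, ∑ c, ∑ d, A b c * A d a * (P a c * P b d - P a d * P b c)
      = ∑ a, ∑ b, ∑ c, ∑ d, P b d * P a c * (A b c * A d a - A b d * A c a) := by
  have e : ∑ a, ∑ b, ∑ c, ∑ d, A b c * A d a * (P a d * P b c)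
      = ∑ a, ∑ b, ∑ c, ∑ d, A b d * A c a * (P a c * P b d) :=
    Finset.sum_congr rfl fun a _ => Finset.sum_congr rfl fun b _ => Finset.sum_comm
  simp only [mul_sub, Finset.sum_sub_distrib, e]
  simp only [← Finset.sum_sub_distrib]
  exact Finset.sum_congr rfl fun a _ => Finset.sum_congr rfl fun b _ =>
    Finset.sum_congr rfl fun c _ => Finset.sum_congr rfl fun d _ => by ring

lemma gauss_contract {γ P : Fin m → Fin m → ℝ} {ℓ n : Fin m → ℝ}
    {R T : Fin m → Fin m → Fin m → Fin m → ℝ}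
    (Pγ : ∀ a b, ∑ c, P c a * γ c b = kd a b - n a * ℓ b) :
    ∑ a, ∑ b, ∑ c, ∑ d, ((∑ f, γ a f * R f b c d) + T a b c d - T a b d c) * P a c * P b d
      = (∑ b, ∑ c, ∑ d, R c b c d * P b d)
        - (∑ a, ∑ b, ∑ c, ∑ d, ℓ a * R a b c d * P b d * n c)
        + ∑ a, ∑ b, ∑ c, ∑ d, T a b c d * (P a c * P b d - P a d * P b c) := by
  have e1 : ∑ a, ∑ b, ∑ c, ∑ d, (∑ f, γ a f * R f b c d) * P a c * P b d
      = (∑ b, ∑ c, ∑ d, R c b c d * P b d)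
        - (∑ a, ∑ b, ∑ c, ∑ d, ℓ a * R a b c d * P b d * n c) := by
    rw [sum3_rotate fun a b c => ∑ d, (∑ f, γ a f * R f b c d) * P a c * P b d,
      sum3_rotate fun a b c => ∑ d, ℓ a * R a b c d * P b d * n c]
    simp only [← Finset.sum_sub_distrib]
    refine Finset.sum_congr rfl fun b _ => Finset.sum_congr rfl fun c _ => ?_
    rw [Finset.sum_comm]
    conv_rhs => rw [Finset.sum_sub_distrib]; enter [2]; rw [Finset.sum_comm]
    rw [← Finset.sum_sub_distrib]
    refine Finset.sum_congr rfl fun d _ => ?_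
    have k : ∑ a, (∑ f, γ a f * R f b c d) * P a c
        = ∑ f, (∑ a, P a c * γ a f) * R f b c d := by
      simp only [Finset.sum_mul]
      rw [Finset.sum_comm]
      exact Finset.sum_congr rfl fun f _ => Finset.sum_congr rfl fun a _ => by ring
    rw [← Finset.sum_mul, k]
    simp only [Pγ, sub_mul, Finset.sum_sub_distrib, sum_kd_mul]
    rw [Finset.sum_mul]
    congr 1
    exact Finset.sum_congr rfl fun a _ => by ring
  have e2 : ∑ a, ∑ b, ∑ c, ∑ d, T a b d c * P a c * P b d
      = ∑ a, ∑ b, ∑ c, ∑ d, T a b c d * P a d * P b c :=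
    Finset.sum_congr rfl fun a _ => Finset.sum_congr rfl fun b _ => Finset.sum_comm
  simp only [sub_mul, add_mul, Finset.sum_sub_distrib, Finset.sum_add_distrib, e1, e2, mul_sub,
    ← mul_assoc]
  ring

lemma skew_contract {P : Fin m → Fin m → ℝ} {n : Fin m → ℝ}
    (S : Fin m → Fin m → Fin m → ℝ) (L : Fin m → Fin m → Fin m → ℝ) :
    ∑ b, ∑ c, ∑ d, (L b c d + S d b c - S c b d) * P b d * n c
      = (∑ b, ∑ c, ∑ d, L b c d * P b d * n c)
        + ∑ b, ∑ c, ∑ d, (P b d * n c - P b c * n d) * S d b c := by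
  have e : ∑ b, ∑ c, ∑ d, S c b d * P b d * n c = ∑ b, ∑ c, ∑ d, P b c * n d * S d b c := by
    refine Finset.sum_congr rfl fun b _ => ?_
    rw [Finset.sum_comm]
    exact Finset.sum_congr rfl fun c _ => Finset.sum_congr rfl fun d _ => by ring
  simp only [sub_mul, add_mul, Finset.sum_sub_distrib, Finset.sum_add_distrib, e]
  rw [add_sub_assoc]
  congr 2
  exact Finset.sum_congr rfl fun b _ => Finset.sum_congr rfl fun c _ =>
    Finset.sum_congr rfl fun d _ => by ring

/-- The quadratic part of the twice contracted Gauss equation. -/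
lemma gauss_quadratic {P Y U F : Fin m → Fin m → ℝ} {ℓ n : Fin m → ℝ} {n2 ℓ2 : ℝ}
    (DU : Fin m → Fin m → Fin m → ℝ) (Ps : ∀ a b, P a b = P b a)
    (Us : ∀ a b, U a b = U b a) (Fa : ∀ a b, F a b = -F b a)
    (Pℓ : ∀ a, ∑ b, P b a * ℓ b = -(ℓ2 * n a)) :
    ∑ a, ∑ b, ∑ c, ∑ d, (Y b c * U d a + n2 * Y b c * Y d a + U b c * (F d a + Y d a)
        + ℓ a * DU d b c) * (P a c * P b d - P a d * P b c)
      = n2 * (∑ a, ∑ b, ∑ c, ∑ d, P b d * P a c * (Y b c * Y d a - Y b d * Y c a))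
        + 2 * (∑ b, ∑ c, Y b c * ((∑ d, P b d * ∑ a, P c a * U d a)
          - P b c * ∑ d, ∑ a, P d a * U d a))
        - ℓ2 * ∑ b, ∑ c, ∑ d, (P b d * n c - P b c * n d) * DU d b c := by
  have e1 := gauss_pair_eq (A := Y) (C := U) Ps
  have e2 := gauss_pair_comm (A := Y) (C := U) Ps
  have e3 := gauss_pair_eq_zero (A := U) (C := F) Ps Us Fa
  have e4 := gauss_pair_self (A := Y) (P := P)
  have e5 : ∑ a, ∑ b, ∑ c, ∑ d, ℓ a * DU d b c * (P a c * P b d - P a d * P b c)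
      = -(ℓ2 * ∑ b, ∑ c, ∑ d, (P b d * n c - P b c * n d) * DU d b c) := by
    rw [sum3_rotate fun a b c => ∑ d, ℓ a * DU d b c * (P a c * P b d - P a d * P b c)]
    simp only [Finset.mul_sum, ← Finset.sum_neg_distrib]
    refine Finset.sum_congr rfl fun b _ => Finset.sum_congr rfl fun c _ => ?_
    rw [Finset.sum_comm]
    refine Finset.sum_congr rfl fun d _ => ?_
    have k : ∑ a, ℓ a * DU d b c * (P a c * P b d - P a d * P b c)
        = DU d b c * (P b d * (∑ a, P a c * ℓ a) - P b c * ∑ a, P a d * ℓ a) := by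
      simp only [Finset.mul_sum, ← Finset.sum_sub_distrib]
      exact Finset.sum_congr rfl fun a _ => by ring
    rw [k, Pℓ, Pℓ]
    ring
  rw [← e4, ← e1]
  have e6 : ∀ a b c d, (Y b c * U d a + n2 * Y b c * Y d a + U b c * (F d a + Y d a)
        + ℓ a * DU d b c) * (P a c * P b d - P a d * P b c)
      = Y b c * U d a * (P a c * P b d - P a d * P b c)
        + n2 * (Y b c * Y d a * (P a c * P b d - P a d * P b c))
        + U b c * F d a * (P a c * P b d - P a d * P b c)
        + U b c * Y d a * (P a c * P b d - P a d * P b c)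
        + ℓ a * DU d b c * (P a c * P b d - P a d * P b c) := fun a b c d => by ring
  simp only [e6, Finset.sum_add_distrib, ← Finset.mul_sum]
  rw [e3, e5, ← e2]
  ring

lemma sum_symm_mul_antisymm {P F : Fin m → Fin m → ℝ} (Ps : ∀ a b, P a b = P b a)
    (Fa : ∀ a b, F a b = -F b a) : ∑ a, ∑ b, P a b * F a b = 0 := by
  have e : ∑ a, ∑ b, P a b * F a b = -∑ a, ∑ b, P a b * F a b := by
    conv_lhs => rw [Finset.sum_comm]
    simp only [← Finset.sum_neg_distrib]
    refine Finset.sum_congr rfl fun a _ => Finset.sum_congr rfl fun b _ => ?_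
    rw [Ps b a, Fa b a]
    ring
  linarith

lemma sum_mul_antisymm {F : Fin m → Fin m → ℝ} (n : Fin m → ℝ)
    (Fa : ∀ a b, F a b = -F b a) (f : Fin m) :
    ∑ d, n d * F d f = -∑ d, n d * F f d := by
  rw [← Finset.sum_neg_distrib]
  exact Finset.sum_congr rfl fun d _ => by rw [Fa d f]; ring

lemma sum_mul_sum_antisymm {F : Fin m → Fin m → ℝ} (n : Fin m → ℝ)
    (Fa : ∀ a b, F a b = -F b a) : ∑ d, n d * ∑ f, n f * F d f = 0 := by
  rw [← sum_symm_mul_antisymm (P := fun a b => n a * n b) (fun a b => mul_comm _ _) Fa]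
  simp only [Finset.mul_sum, mul_assoc]

lemma sum_mul_contract_antisymm {P F : Fin m → Fin m → ℝ} (n : Fin m → ℝ)
    (Fa : ∀ a b, F a b = -F b a) (b : Fin m) :
    ∑ d, n d * ∑ f, P b f * F d f = -∑ e, P b e * ∑ f, n f * F e f := by
  have e : ∑ d, n d * ∑ f, P b f * F d f = ∑ e, P b e * ∑ d, n d * F d e := by
    simp only [Finset.mul_sum]
    rw [Finset.sum_comm]
    exact Finset.sum_congr rfl fun e _ => Finset.sum_congr rfl fun d _ => by ring
  simp only [e, sum_mul_antisymm n Fa, mul_neg, Finset.sum_neg_distrib]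

/-- The covariant derivatives of the inverse blocks, as prescribed by the metric hypersurface
connection, at a single point. -/
structure InverseDerivs (P U F : Fin m → Fin m → ℝ) (n lam : Fin m → ℝ) (n2 : ℝ)
    (DP : Fin m → Fin m → Fin m → ℝ) (Dn : Fin m → Fin m → ℝ) : Prop where
  Ps : ∀ a b, P a b = P b a
  Us : ∀ a b, U a b = U b a
  Fa : ∀ a b, F a b = -F b a
  DP_eq : ∀ c a b, DP c a b
    = -(n a * ∑ f, P b f * F c f) - n b * (∑ f, P a f * F c f) - n a * n b * lam c
  Dn_eq : ∀ c a, Dn c a = (∑ f, P a f * U c f) - n2 * (∑ f, P a f * F c f)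
    - n a * ((∑ f, n f * F c f) + n2 * lam c)

namespace InverseDerivs

variable {P U F Dn : Fin m → Fin m → ℝ} {n lam : Fin m → ℝ} {n2 : ℝ}
  {DP : Fin m → Fin m → Fin m → ℝ}

lemma sum_DP (h : InverseDerivs P U F n lam n2 DP Dn) (b : Fin m) :
    ∑ d, DP d b d = (∑ e, P b e * ∑ f, n f * F e f) - n b * ∑ d, n d * lam d := by
  have z := sum_symm_mul_antisymm h.Ps h.Fa
  have q := sum_mul_contract_antisymm (P := P) n h.Fa b
  have r : ∑ d, n b * n d * lam d = n b * ∑ d, n d * lam d := by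
    rw [Finset.mul_sum]
    exact Finset.sum_congr rfl fun d _ => by ring
  simp only [h.DP_eq, Finset.sum_sub_distrib, Finset.sum_neg_distrib, r, q]
  rw [← Finset.mul_sum, z]
  ring

lemma sum_mul_DP (h : InverseDerivs P U F n lam n2 DP Dn) (b c : Fin m) :
    ∑ d, n d * DP d b c = n b * (∑ e, P c e * ∑ f, n f * F e f)
      + n c * (∑ e, P b e * ∑ f, n f * F e f) - n b * n c * ∑ d, n d * lam d := by
  have e : ∀ d, n d * DP d b c = -(n b * (n d * ∑ f, P c f * F d f))
      - n c * (n d * ∑ f, P b f * F d f) - n b * n c * (n d * lam d) := fun d => by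
    rw [h.DP_eq]
    ring
  simp only [e, Finset.sum_sub_distrib, Finset.sum_neg_distrib, ← Finset.mul_sum,
    sum_mul_contract_antisymm n h.Fa]
  ring

lemma sum_mul_Dn (h : InverseDerivs P U F n lam n2 DP Dn) (b c : Fin m) :
    ∑ d, P b d * Dn d c = (∑ d, P b d * ∑ a, P c a * U d a)
      - n2 * (∑ d, P b d * ∑ a, P c a * F d a)
      - n c * ((∑ e, P b e * ∑ f, n f * F e f) + n2 * ∑ d, P b d * lam d) := by
  have e : ∀ d, P b d * Dn d c = P b d * (∑ a, P c a * U d a)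
      - n2 * (P b d * ∑ a, P c a * F d a)
      - (n c * (P b d * ∑ f, n f * F d f) + n c * n2 * (P b d * lam d)) := fun d => by
    rw [h.Dn_eq]
    ring
  simp only [e, Finset.sum_sub_distrib, Finset.sum_add_distrib, ← Finset.mul_sum]
  ring

lemma sum_Dn (h : InverseDerivs P U F n lam n2 DP Dn) :
    ∑ d, Dn d d = (∑ d, ∑ a, P d a * U d a) - n2 * ∑ d, n d * lam d := by
  have e : ∀ d, Dn d d = (∑ a, P d a * U d a) - n2 * (∑ a, P d a * F d a)
      - (n d * (∑ f, n f * F d f) + n2 * (n d * lam d)) := fun d => by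
    rw [h.Dn_eq]
    ring
  simp only [e, Finset.sum_sub_distrib, Finset.sum_add_distrib, ← Finset.mul_sum]
  rw [sum_symm_mul_antisymm h.Ps h.Fa, sum_mul_sum_antisymm n h.Fa]
  ring

end InverseDerivs

lemma sum_skew_mul {P Y : Fin m → Fin m → ℝ} (n g : Fin m → ℝ) :
    ∑ b, ∑ c, ∑ d, (P b d * n c - P b c * n d) * (Y b c * g d)
      = ∑ b, ∑ c, Y b c * (n c * (∑ d, P b d * g d) - P b c * ∑ d, n d * g d) := by
  refine Finset.sum_congr rfl fun b _ => Finset.sum_congr rfl fun c _ => ?_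
  simp only [Finset.mul_sum, ← Finset.sum_sub_distrib]
  exact Finset.sum_congr rfl fun d _ => by ring

/-- The algebraic identity behind the normal-transversal constraint. -/
lemma normal_transversal_algebra {γ P Y U F Dn : Fin m → Fin m → ℝ} {ℓ n lam : Fin m → ℝ}
    {n2 ℓ2 : ℝ} {R : Fin m → Fin m → Fin m → Fin m → ℝ} {DY DU DP : Fin m → Fin m → Fin m → ℝ}
    (h : InverseDerivs P U F n lam n2 DP Dn) (Ys : ∀ a b, Y a b = Y b a)
    (Pγ : ∀ a b, ∑ c, P c a * γ c b = kd a b - n a * ℓ b)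
    (Pℓ : ∀ a, ∑ b, P b a * ℓ b = -(ℓ2 * n a)) :
    (∑ b, ∑ c, ∑ d, ((∑ a, ℓ a * R a b c d)
        + (DY d b c - Y b c * ((∑ f, n f * Y d f) + (∑ f, n f * F d f) + n2 * lam d / 2)
          + U b c * lam d / 2 + ℓ2 * DU d b c)
        - (DY c b d - Y b d * ((∑ f, n f * Y c f) + (∑ f, n f * F c f) + n2 * lam c / 2)
          + U b d * lam c / 2 + ℓ2 * DU c b d)) * P b d * n c)
      + (∑ a, ∑ b, ∑ c, ∑ d, ((∑ f, γ a f * R f b c d)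
        + (Y b c * U d a + n2 * Y b c * Y d a + U b c * (F d a + Y d a) + ℓ a * DU d b c)
        - (Y b d * U c a + n2 * Y b d * Y c a + U b d * (F c a + Y c a) + ℓ a * DU c b d))
          * P a c * P b d) / 2
      = (∑ b, ∑ c, ∑ d, R c b c d * P b d) / 2
        + (∑ a, ∑ b, ∑ c, ∑ d, ℓ a * R a b c d * P b d * n c) / 2
        + ((∑ b, ∑ c, ∑ d, (P b d * n c - P b c * n d) * DY d b c)
          + ∑ b, ∑ c, Y b c * ((∑ d, DP d b d) * n c + (∑ d, P b d * Dn d c)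
            - (∑ d, n d * DP d b c) - P b c * ∑ d, Dn d d))
        + n2 * (∑ a, ∑ b, ∑ c, ∑ d, P b d * P a c * (Y b c * Y d a - Y b d * Y c a)) / 2
        + (∑ b, ∑ c, ∑ d, (P b d * n c - P b c * n d)
            * (ℓ2 * DU d b c + (U b c + n2 * Y b c) * lam d
              + 2 * Y b c * (∑ f, (F d f - Y d f) * n f))) / 2 := by
  rw [skew_contract (fun d b c => DY d b c
      - Y b c * ((∑ f, n f * Y d f) + (∑ f, n f * F d f) + n2 * lam d / 2)
      + U b c * lam d / 2 + ℓ2 * DU d b c) fun b c d => ∑ a, ℓ a * R a b c d,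
    gauss_contract (T := fun a b c d => Y b c * U d a + n2 * Y b c * Y d a
      + U b c * (F d a + Y d a) + ℓ a * DU d b c) Pγ,
    gauss_quadratic DU h.Ps h.Us h.Fa Pℓ]
  have hL : ∑ b, ∑ c, ∑ d, (∑ a, ℓ a * R a b c d) * P b d * n c
      = ∑ a, ∑ b, ∑ c, ∑ d, ℓ a * R a b c d * P b d * n c := by
    simp only [Finset.sum_mul]
    exact (sum4_rotate fun b c d a => ℓ a * R a b c d * P b d * n c).symm
  have hf : ∀ d, ∑ f, (F d f - Y d f) * n f = (∑ f, n f * F d f) - ∑ f, n f * Y d f := by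
    intro d
    rw [← Finset.sum_sub_distrib]
    exact Finset.sum_congr rfl fun f _ => by ring
  have hS : ∑ b, ∑ c, ∑ d, (P b d * n c - P b c * n d) * (DY d b c
        - Y b c * ((∑ f, n f * Y d f) + (∑ f, n f * F d f) + n2 * lam d / 2)
        + U b c * lam d / 2 + ℓ2 * DU d b c)
      = (∑ b, ∑ c, ∑ d, (P b d * n c - P b c * n d) * DY d b c)
        + (∑ b, ∑ c, ∑ d, (P b d * n c - P b c * n d)
            * (ℓ2 * DU d b c + (U b c + n2 * Y b c) * lam d
              + 2 * Y b c * (∑ f, (F d f - Y d f) * n f))) / 2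
        + ℓ2 * (∑ b, ∑ c, ∑ d, (P b d * n c - P b c * n d) * DU d b c) / 2
        - 2 * (∑ b, ∑ c, ∑ d, (P b d * n c - P b c * n d) * (Y b c * ∑ f, n f * F d f))
        - n2 * ∑ b, ∑ c, ∑ d, (P b d * n c - P b c * n d) * (Y b c * lam d) := by
    simp only [Finset.mul_sum, Finset.sum_div, ← Finset.sum_sub_distrib,
      ← Finset.sum_add_distrib]
    refine Finset.sum_congr rfl fun b _ => Finset.sum_congr rfl fun c _ =>
      Finset.sum_congr rfl fun d _ => ?_
    simp only [← Finset.mul_sum, hf, Finset.sum_add_distrib]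
    ring
  have hZ : ∑ b, ∑ c, Y b c * ((∑ d, DP d b d) * n c + (∑ d, P b d * Dn d c)
        - (∑ d, n d * DP d b c) - P b c * ∑ d, Dn d d)
      = (∑ b, ∑ c, Y b c * ((∑ d, P b d * ∑ a, P c a * U d a)
          - P b c * ∑ d, ∑ a, P d a * U d a))
        - 2 * (∑ b, ∑ c, ∑ d, (P b d * n c - P b c * n d) * (Y b c * ∑ f, n f * F d f))
        - n2 * ∑ b, ∑ c, ∑ d, (P b d * n c - P b c * n d) * (Y b c * lam d) := by
    rw [sum_skew_mul, sum_skew_mul, sum_mul_sum_antisymm n h.Fa]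
    have z := sum_symm_mul_antisymm (P := Y) (F := fun b c =>
      n c * (∑ e, P b e * ∑ f, n f * F e f) - n b * (∑ e, P c e * ∑ f, n f * F e f)
        - n2 * ∑ d, P b d * ∑ a, P c a * F d a) Ys fun b c => by
      have k : ∑ d, P b d * ∑ a, P c a * F d a = -∑ d, P c d * ∑ a, P b a * F d a := by
        simp only [Finset.mul_sum, ← Finset.sum_neg_distrib]
        rw [Finset.sum_comm]
        refine Finset.sum_congr rfl fun d _ => Finset.sum_congr rfl fun a _ => ?_
        rw [h.Fa a d]
        ring
      rw [k]
      ring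
    rw [← sub_eq_zero]
    refine Eq.trans ?_ z
    simp only [h.sum_DP, h.sum_mul_DP, h.sum_mul_Dn, h.sum_Dn]
    have comb : ∀ A B C D Z : Fin m → Fin m → ℝ,
        (∀ b c, A b c - (B b c - 2 * C b c - n2 * D b c) = Z b c) →
        (∑ b, ∑ c, A b c) - ((∑ b, ∑ c, B b c) - 2 * (∑ b, ∑ c, C b c)
          - n2 * ∑ b, ∑ c, D b c) = ∑ b, ∑ c, Z b c := by
      intro A B C D Z hZ
      simp only [← hZ, Finset.sum_sub_distrib, Finset.mul_sum]
    exact comb _ _ _ _ _ fun b c => by ring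
  rw [hL, hS, hZ]
  ring

lemma normal_contract {γ P : Fin m → Fin m → ℝ} {ℓ n : Fin m → ℝ} {n2 : ℝ}
    {R : Fin m → Fin m → Fin m → Fin m → ℝ} (γn : ∀ a, ∑ b, n b * γ b a = -(n2 * ℓ a))
    (c : Fin m) :
    ∑ a, ∑ b, ∑ d, (∑ f, γ a f * R f b c d) * n a * P b d
      = -(n2 * ∑ b, ∑ d, (∑ a, ℓ a * R a b c d) * P b d) := by
  rw [sum3_rotate fun a b d => (∑ f, γ a f * R f b c d) * n a * P b d]
  simp only [Finset.mul_sum, ← Finset.sum_neg_distrib]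
  refine Finset.sum_congr rfl fun b _ => Finset.sum_congr rfl fun d _ => ?_
  have k : ∑ a, (∑ f, γ a f * R f b c d) * n a = ∑ f, (∑ a, n a * γ a f) * R f b c d := by
    simp only [Finset.sum_mul]
    rw [Finset.sum_comm]
    exact Finset.sum_congr rfl fun f _ => Finset.sum_congr rfl fun a _ => by ring
  rw [← Finset.sum_mul, k]
  simp only [γn, Finset.sum_mul, Finset.mul_sum, ← Finset.sum_neg_distrib]
  exact Finset.sum_congr rfl fun f _ => by ring

/-- The contraction of the quadratic Gauss term with the vector `n`. -/
lemma sum_normal_mul_gauss {Y U F : Fin m → Fin m → ℝ} {ℓ n : Fin m → ℝ} {n2 ℓ2 : ℝ}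
    {DU : Fin m → Fin m → Fin m → ℝ} (nℓ : ∑ a, n a * ℓ a = 1 - n2 * ℓ2) (b c d : Fin m) :
    ∑ a, n a * (Y b c * U d a + n2 * Y b c * Y d a + U b c * (F d a + Y d a)
        + ℓ a * DU d b c)
      = Y b c * (∑ a, n a * U d a) + n2 * Y b c * (∑ a, n a * Y d a)
        + U b c * ((∑ a, n a * F d a) + ∑ a, n a * Y d a)
        + (1 - n2 * ℓ2) * DU d b c := by
  rw [← nℓ]
  simp only [Finset.mul_sum, Finset.sum_mul, ← Finset.sum_add_distrib]
  exact Finset.sum_congr rfl fun a _ => by ring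

namespace InverseDerivs

variable {P U F Dn : Fin m → Fin m → ℝ} {n lam dn2 : Fin m → ℝ} {n2 : ℝ}
  {DP DW : Fin m → Fin m → Fin m → ℝ}

lemma sum_DW (h : InverseDerivs P U F n lam n2 DP Dn)
    (hdn2 : ∀ c, dn2 c = 2 * (∑ f, n f * U c f) - 2 * n2 * (∑ f, n f * F c f)
      - n2 * n2 * lam c)
    (hDW : ∀ a b d, DW a b d = dn2 a * P b d + n2 * DP a b d - Dn a b * n d - n b * Dn a d)
    (b : Fin m) :
    ∑ d, DW d b d = (∑ e, P b e * ∑ f, n f * U e f)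
      - 2 * n2 * (∑ e, P b e * ∑ f, n f * F e f) - n2 * n2 * (∑ e, P b e * lam e)
      + n2 * n b * (∑ d, n d * lam d) - n b * ∑ d, ∑ a, P d a * U d a := by
  have e1 : ∑ d, dn2 d * P b d = 2 * (∑ e, P b e * ∑ f, n f * U e f)
      - 2 * n2 * (∑ e, P b e * ∑ f, n f * F e f) - n2 * n2 * ∑ e, P b e * lam e := by
    simp only [Finset.mul_sum (a := (2 : ℝ)), Finset.mul_sum (a := 2 * n2),
      Finset.mul_sum (a := n2 * n2), ← Finset.sum_sub_distrib]
    refine Finset.sum_congr rfl fun d _ => ?_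
    rw [hdn2]
    ring
  have e2 : ∑ d, Dn d b * n d = (∑ e, P b e * ∑ f, n f * U e f)
      + n2 * (∑ e, P b e * ∑ f, n f * F e f) - n b * n2 * ∑ d, n d * lam d := by
    have k : ∀ d, Dn d b * n d = n d * (∑ f, P b f * U d f) - n2 * (n d * ∑ f, P b f * F d f)
        - n b * (n d * ∑ f, n f * F d f) - n b * n2 * (n d * lam d) := fun d => by
      rw [h.Dn_eq]
      ring
    have q : ∑ d, n d * (∑ f, P b f * U d f) = ∑ e, P b e * ∑ f, n f * U e f := by
      simp only [Finset.mul_sum]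
      rw [Finset.sum_comm]
      refine Finset.sum_congr rfl fun e _ => Finset.sum_congr rfl fun f _ => ?_
      rw [h.Us e f]
      ring
    simp only [k, Finset.sum_sub_distrib, ← Finset.mul_sum, q,
      sum_mul_contract_antisymm n h.Fa, sum_mul_sum_antisymm n h.Fa]
    ring
  simp only [hDW, Finset.sum_sub_distrib, Finset.sum_add_distrib, ← Finset.mul_sum, e1, e2,
    h.sum_DP, h.sum_Dn]
  ring

/-- The trace of `DW` in the derivative-free pair of slots against a symmetric tensor `Y`. -/
lemma sum_DW_mul {Y : Fin m → Fin m → ℝ} (h : InverseDerivs P U F n lam n2 DP Dn)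
    (Ys : ∀ a b, Y a b = Y b a)
    (hdn2 : ∀ c, dn2 c = 2 * (∑ f, n f * U c f) - 2 * n2 * (∑ f, n f * F c f)
      - n2 * n2 * lam c)
    (hDW : ∀ a b d, DW a b d = dn2 a * P b d + n2 * DP a b d - Dn a b * n d - n b * Dn a d)
    (c : Fin m) :
    ∑ b, ∑ d, DW c b d * Y b d
      = (2 * (∑ f, n f * U c f) - 2 * n2 * (∑ f, n f * F c f) - n2 * n2 * lam c)
          * (∑ b, ∑ d, P b d * Y b d)
        + n2 * (∑ b, n b * ∑ f, n f * Y b f) * lam c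
        - 2 * (∑ b, (∑ f, P b f * U c f) * ∑ f, n f * Y b f)
        + 2 * (∑ b, n b * ∑ f, n f * Y b f) * ∑ f, n f * F c f := by
  have e : ∀ v w : Fin m → ℝ, (∑ b, ∑ d, v b * w d * Y b d) = ∑ b, v b * ∑ f, w f * Y b f := by
    intro v w
    simp only [Finset.mul_sum, mul_assoc]
  have e' : ∀ v w : Fin m → ℝ, (∑ b, ∑ d, v b * w d * Y b d) = ∑ b, ∑ d, w b * v d * Y b d := by
    intro v w
    rw [Finset.sum_comm]
    refine Finset.sum_congr rfl fun b _ => Finset.sum_congr rfl fun d _ => ?_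
    rw [Ys]
    ring
  have k : ∀ b d, DW c b d * Y b d = dn2 c * (P b d * Y b d)
      - n2 * (n b * (∑ f, P d f * F c f) * Y b d)
      - n2 * ((∑ f, P b f * F c f) * n d * Y b d) - n2 * lam c * (n b * n d * Y b d)
      - (∑ f, P b f * U c f) * n d * Y b d + n2 * ((∑ f, P b f * F c f) * n d * Y b d)
      + ((∑ f, n f * F c f) + n2 * lam c) * (n b * n d * Y b d)
      - n b * (∑ f, P d f * U c f) * Y b d + n2 * (n b * (∑ f, P d f * F c f) * Y b d)
      + ((∑ f, n f * F c f) + n2 * lam c) * (n b * n d * Y b d) := fun b d => by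
    rw [hDW, h.DP_eq, h.Dn_eq, h.Dn_eq]
    ring
  simp only [k, Finset.sum_sub_distrib, Finset.sum_add_distrib, ← Finset.mul_sum]
  rw [e' n fun d => ∑ f, P d f * U c f, e n n, e (fun d => ∑ f, P d f * U c f) n, hdn2]
  ring

end InverseDerivs

/-- Collecting the terms of the normal-tangential constraint into elementary contractions. -/
lemma normal_tangential_collect (P Y U L A A' B B' : Fin m → Fin m → ℝ)
    (n u f y lam p : Fin m → ℝ) (n2 ℓ2 : ℝ) (c : Fin m) :
    (∑ b, ∑ d, (L b d + (A b d - Y b c * (y d + f d + n2 * lam d / 2) + U b c * lam d / 2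
          + ℓ2 * B b d) - (A' b d - Y b d * (y c + f c + n2 * lam c / 2) + U b d * lam c / 2
          + ℓ2 * B' b d)) * (n2 * P b d - n b * n d))
      + (-(n2 * ∑ b, ∑ d, L b d * P b d)
        + ∑ b, ∑ d, P b d * ((Y b c * u d + n2 * Y b c * y d + U b c * (f d + y d)
            + (1 - n2 * ℓ2) * B b d)
          - (Y b d * u c + n2 * Y b d * y c + U b d * (f c + y c) + (1 - n2 * ℓ2) * B' b d)))
      = -(∑ b, ∑ d, L b d * (n b * n d))
        + (∑ b, ∑ d, (n2 * P b d - n b * n d) * (A b d - A' b d))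
        + (∑ b, ∑ d, (P b d - ℓ2 * n b * n d) * (B b d - B' b d))
        + (∑ b, ∑ d, (n2 * P b d - n b * n d)
            * ((U b c + n2 * Y b c) * lam d / 2 - (U b d + n2 * Y b d) * lam c / 2
              + (Y b c * f d - Y b d * f c)))
        + (∑ b, ∑ d, (P b d * Y b d * u c - n d * Y b d * p b))
        + (∑ b, ∑ d, P b d * (U b c * f d - U b d * f c))
        + ((∑ b, ∑ d, P b d * u d * Y b c) - 2 * n2 * (∑ b, ∑ d, P b d * f d * Y b c)
          - n2 * n2 * (∑ b, ∑ d, P b d * lam d * Y b c)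
          + (∑ b, ∑ d, n d * y d * (n b * Y b c)) + 2 * (∑ b, ∑ d, n d * f d * (n b * Y b c))
          + n2 * (∑ b, ∑ d, n d * lam d * (n b * Y b c))
          + (2 * n2 * f c + n2 * n2 * lam c - 2 * u c) * (∑ b, ∑ d, P b d * Y b d)
          - (y c + 2 * f c + n2 * lam c) * (∑ b, ∑ d, n b * (n d * Y b d))
          + (∑ b, ∑ d, P b d * U b c * y d) - y c * (∑ b, ∑ d, P b d * U b d)
          + ∑ b, ∑ d, p b * (n d * Y b d)) := by
  simp only [Finset.mul_sum, ← Finset.sum_sub_distrib, ← Finset.sum_add_distrib,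
    ← Finset.sum_neg_distrib]
  exact Finset.sum_congr rfl fun b _ => Finset.sum_congr rfl fun d _ => by ring

/-- The algebraic identity behind the normal-tangential constraint. -/
lemma normal_tangential_algebra {γ P Y U F Dn : Fin m → Fin m → ℝ} {ℓ n lam dn2 : Fin m → ℝ}
    {n2 ℓ2 : ℝ} {R : Fin m → Fin m → Fin m → Fin m → ℝ}
    {DY DU DP DW : Fin m → Fin m → Fin m → ℝ}
    (h : InverseDerivs P U F n lam n2 DP Dn) (Ys : ∀ a b, Y a b = Y b a)
    (hdn2 : ∀ c, dn2 c = 2 * (∑ f, n f * U c f) - 2 * n2 * (∑ f, n f * F c f)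
      - n2 * n2 * lam c)
    (hDW : ∀ a b d, DW a b d = dn2 a * P b d + n2 * DP a b d - Dn a b * n d - n b * Dn a d)
    (γn : ∀ a, ∑ b, n b * γ b a = -(n2 * ℓ a))
    (nℓ : ∑ a, n a * ℓ a = 1 - n2 * ℓ2) (c : Fin m) :
    (∑ b, ∑ d, ((∑ a, ℓ a * R a b c d)
        + (DY d b c - Y b c * ((∑ f, n f * Y d f) + (∑ f, n f * F d f) + n2 * lam d / 2)
          + U b c * lam d / 2 + ℓ2 * DU d b c)
        - (DY c b d - Y b d * ((∑ f, n f * Y c f) + (∑ f, n f * F c f) + n2 * lam c / 2)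
          + U b d * lam c / 2 + ℓ2 * DU c b d)) * (n2 * P b d - n b * n d))
      + (∑ a, ∑ b, ∑ d, ((∑ f, γ a f * R f b c d)
        + (Y b c * U d a + n2 * Y b c * Y d a + U b c * (F d a + Y d a) + ℓ a * DU d b c)
        - (Y b d * U c a + n2 * Y b d * Y c a + U b d * (F c a + Y c a) + ℓ a * DU c b d))
          * n a * P b d)
      = -(∑ a, ∑ b, ∑ d, ℓ a * R a b c d * n b * n d)
        + ((∑ b, ∑ d, (n2 * P b d - n b * n d) * (DY d b c - DY c b d))
          + (∑ b, (∑ d, DW d b d) * Y b c) - ∑ b, ∑ d, DW c b d * Y b d)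
        + (∑ b, ∑ d, (P b d - ℓ2 * n b * n d) * (DU d b c - DU c b d))
        + (∑ b, ∑ d, (n2 * P b d - n b * n d)
            * ((U b c + n2 * Y b c) * lam d / 2 - (U b d + n2 * Y b d) * lam c / 2
              + ∑ f, (Y b c * F d f - Y b d * F c f) * n f))
        + (∑ b, ∑ d, ∑ f, (P b d * n f - P b f * n d) * Y b d * U c f)
        + (∑ b, ∑ d, ∑ f, P b d * n f * (U b c * F d f - U b d * F c f)) := by
  have hII : ∑ a, ∑ b, ∑ d, ((∑ f, γ a f * R f b c d)
        + (Y b c * U d a + n2 * Y b c * Y d a + U b c * (F d a + Y d a) + ℓ a * DU d b c)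
        - (Y b d * U c a + n2 * Y b d * Y c a + U b d * (F c a + Y c a) + ℓ a * DU c b d))
          * n a * P b d
      = -(n2 * ∑ b, ∑ d, (∑ a, ℓ a * R a b c d) * P b d)
        + ∑ b, ∑ d, P b d * ((Y b c * (∑ a, n a * U d a) + n2 * Y b c * (∑ a, n a * Y d a)
          + U b c * ((∑ a, n a * F d a) + ∑ a, n a * Y d a) + (1 - n2 * ℓ2) * DU d b c)
          - (Y b d * (∑ a, n a * U c a) + n2 * Y b d * (∑ a, n a * Y c a)
          + U b d * ((∑ a, n a * F c a) + ∑ a, n a * Y c a) + (1 - n2 * ℓ2) * DU c b d)) := by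
    have k : ∑ b, ∑ d, P b d * ((Y b c * (∑ a, n a * U d a) + n2 * Y b c * (∑ a, n a * Y d a)
          + U b c * ((∑ a, n a * F d a) + ∑ a, n a * Y d a) + (1 - n2 * ℓ2) * DU d b c)
          - (Y b d * (∑ a, n a * U c a) + n2 * Y b d * (∑ a, n a * Y c a)
          + U b d * ((∑ a, n a * F c a) + ∑ a, n a * Y c a) + (1 - n2 * ℓ2) * DU c b d))
        = ∑ a, ∑ b, ∑ d, ((Y b c * U d a + n2 * Y b c * Y d a + U b c * (F d a + Y d a)
            + ℓ a * DU d b c)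
          - (Y b d * U c a + n2 * Y b d * Y c a + U b d * (F c a + Y c a) + ℓ a * DU c b d))
            * n a * P b d := by
      rw [sum3_rotate]
      refine Finset.sum_congr rfl fun b _ => Finset.sum_congr rfl fun d _ => ?_
      rw [← sum_normal_mul_gauss nℓ, ← sum_normal_mul_gauss nℓ, ← Finset.sum_sub_distrib,
        Finset.mul_sum]
      exact Finset.sum_congr rfl fun a _ => by ring
    rw [k, ← normal_contract γn]
    simp only [← Finset.sum_add_distrib]
    exact Finset.sum_congr rfl fun a _ => Finset.sum_congr rfl fun b _ =>
      Finset.sum_congr rfl fun d _ => by ring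
  have hL : ∑ a, ∑ b, ∑ d, ℓ a * R a b c d * n b * n d
      = ∑ b, ∑ d, (∑ a, ℓ a * R a b c d) * (n b * n d) := by
    rw [sum3_rotate fun a b d => ℓ a * R a b c d * n b * n d]
    simp only [Finset.sum_mul, mul_assoc]
  have hPU : ∑ b, ∑ d, ∑ f, (P b d * n f - P b f * n d) * Y b d * U c f
      = ∑ b, ∑ d, (P b d * Y b d * (∑ f, n f * U c f) - n d * Y b d * ∑ f, P b f * U c f) := by
    simp only [Finset.mul_sum, ← Finset.sum_sub_distrib]
    exact Finset.sum_congr rfl fun b _ => Finset.sum_congr rfl fun d _ =>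
      Finset.sum_congr rfl fun f _ => by ring
  have hUF : ∑ b, ∑ d, ∑ f, P b d * n f * (U b c * F d f - U b d * F c f)
      = ∑ b, ∑ d, P b d * (U b c * (∑ f, n f * F d f) - U b d * ∑ f, n f * F c f) := by
    simp only [Finset.mul_sum, ← Finset.sum_sub_distrib]
    exact Finset.sum_congr rfl fun b _ => Finset.sum_congr rfl fun d _ =>
      Finset.sum_congr rfl fun f _ => by ring
  have hYF : ∀ b d, ∑ f, (Y b c * F d f - Y b d * F c f) * n f
      = Y b c * (∑ f, n f * F d f) - Y b d * ∑ f, n f * F c f := by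
    intro b d
    simp only [Finset.mul_sum, ← Finset.sum_sub_distrib]
    exact Finset.sum_congr rfl fun f _ => by ring
  rw [hII, hL, hPU, hUF, h.sum_DW_mul Ys hdn2 hDW]
  simp only [hYF, h.sum_DW hdn2 hDW]
  have hYn : ∑ b, n b * Y b c = ∑ f, n f * Y c f :=
    Finset.sum_congr rfl fun b _ => by rw [Ys]
  have hP : ∀ g : Fin m → ℝ, ∑ b, ∑ d, P b d * g d * Y b c = ∑ b, (∑ d, P b d * g d) * Y b c :=
    fun g => Finset.sum_congr rfl fun b _ => by rw [Finset.sum_mul]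
  have hn : ∀ g : Fin m → ℝ, ∑ b, ∑ d, n d * g d * (n b * Y b c)
      = (∑ d, n d * g d) * ∑ f, n f * Y c f := by
    intro g
    rw [← hYn]
    simp only [← Finset.sum_mul, ← Finset.mul_sum]
  have hq : ∀ g : Fin m → ℝ, ∑ b, ∑ d, g b * (n d * Y b d) = ∑ b, g b * ∑ f, n f * Y b f :=
    fun g => Finset.sum_congr rfl fun b _ => by rw [Finset.mul_sum]
  have hβ : ∀ g : Fin m → ℝ, ∑ b, ∑ d, P b d * U b c * g d
      = ∑ b, (∑ f, P b f * U c f) * g b := by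
    intro g
    rw [Finset.sum_comm]
    refine Finset.sum_congr rfl fun b _ => ?_
    rw [Finset.sum_mul]
    exact Finset.sum_congr rfl fun f _ => by rw [h.Ps f b, h.Us f c]
  have hY : ∀ (v w z : Fin m → ℝ) (r t : ℝ),
      ∑ b, (v b - 2 * n2 * w b - n2 * n2 * z b + n2 * n b * r - n b * t) * Y b c
      = (∑ b, v b * Y b c) - 2 * n2 * (∑ b, w b * Y b c) - n2 * n2 * (∑ b, z b * Y b c)
        + n2 * r * (∑ f, n f * Y c f) - t * ∑ f, n f * Y c f := by
    intro v w z r t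
    rw [← hYn]
    simp only [Finset.mul_sum, ← Finset.sum_sub_distrib, ← Finset.sum_add_distrib]
    exact Finset.sum_congr rfl fun b _ => by ring
  rw [normal_tangential_collect P Y U (fun b d => ∑ a, ℓ a * R a b c d) (fun b d => DY d b c)
    (fun b d => DY c b d) (fun b d => DU d b c) (fun b d => DU c b d) n
    (fun d => ∑ f, n f * U d f) (fun d => ∑ f, n f * F d f) (fun d => ∑ f, n f * Y d f) lam
    (fun b => ∑ f, P b f * U c f)]
  simp only [hP, hn, hq, hβ, hY (fun b => ∑ e, P b e * ∑ f, n f * U e f)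
    (fun b => ∑ e, P b e * ∑ f, n f * F e f) fun b => ∑ e, P b e * lam e,
    sum_mul_sum_antisymm n h.Fa]
  ring

end MetricData

/-- Theorem 2 of the paper, the constraint equations for a general
hypersurface written in terms of the metric hypersurface connection `Γ̊`, with all
dependence on the extrinsic tensor `Y` explicit. -/
theorem statement15 (m : ℕ) (hm : 1 ≤ m) (U : Set (Fin m → ℝ)) (hU : IsOpen U)
    (γ : Ten m) (ℓ : Vec m) (ℓ2 : Sc m) (P : Ten m) (n : Vec m) (n2 : Sc m)
    (hdata : MetricData U γ ℓ ℓ2 P n n2)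
    (Y : Ten m) (hYsm : SmTen U Y) (hYs : ∀ x ∈ U, ∀ a b, Y x a b = Y x b a) :
    -- (1): the normal-transversal constraint (−G(n,ℓ) for embedded data)
    ((∀ x ∈ U,
      (∑ b, ∑ c, ∑ d, Idef γ ℓ ℓ2 P n n2 Y x b c d * P x b d * n x c)
        + (∑ a, ∑ b, ∑ c, ∑ d,
            IIdef γ ℓ ℓ2 P n n2 Y x a b c d * P x a c * P x b d) / 2
      = (∑ b, ∑ c, ∑ d, curv (Gam0 γ ℓ P n) x c b c d * P x b d) / 2
        + (∑ a, ∑ b, ∑ c, ∑ d,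
            ℓ x a * curv (Gam0 γ ℓ P n) x a b c d * P x b d * n x c) / 2
        + (∑ d, covD1U (Gam0 γ ℓ P n)
            (fun y d' => ∑ b, ∑ c, (P y b d' * n y c - P y b c * n y d') * Y y b c)
            x d d)
        + n2 x * (∑ a, ∑ b, ∑ c, ∑ d, P x b d * P x a c
            * (Y x b c * Y x d a - Y x b d * Y x c a)) / 2
        + (∑ b, ∑ c, ∑ d, (P x b d * n x c - P x b c * n x d)
            * (ℓ2 x * covD2 (Gam0 γ ℓ P n) (Uf γ ℓ n n2) x d b c
              + (Uf γ ℓ n n2 x b c + n2 x * Y x b c) * pd d ℓ2 x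
              + 2 * Y x b c * (∑ f, (Ff ℓ x d f - Y x d f) * n x f))) / 2)
    -- (2): the normal-tangential constraint (−G(n,e_c) for embedded data)
    ∧ (∀ x ∈ U, ∀ c,
      (∑ b, ∑ d, Idef γ ℓ ℓ2 P n n2 Y x b c d
          * (n2 x * P x b d - n x b * n x d))
        + (∑ a, ∑ b, ∑ d, IIdef γ ℓ ℓ2 P n n2 Y x a b c d * n x a * P x b d)
      = -(∑ a, ∑ b, ∑ d,
            ℓ x a * curv (Gam0 γ ℓ P n) x a b c d * n x b * n x d)
        + (∑ f, covD11 (Gam0 γ ℓ P n)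
            (fun y f' c' => ∑ b, ∑ d, (n2 y * P y b d - n y b * n y d)
              * (kd f' d * Y y b c' - kd f' c' * Y y b d)) x f f c)
        + (∑ b, ∑ d, (P x b d - ℓ2 x * n x b * n x d)
            * (covD2 (Gam0 γ ℓ P n) (Uf γ ℓ n n2) x d b c
              - covD2 (Gam0 γ ℓ P n) (Uf γ ℓ n n2) x c b d))
        + (∑ b, ∑ d, (n2 x * P x b d - n x b * n x d)
            * ((Uf γ ℓ n n2 x b c + n2 x * Y x b c) * pd d ℓ2 x / 2
              - (Uf γ ℓ n n2 x b d + n2 x * Y x b d) * pd c ℓ2 x / 2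
              + ∑ f, (Y x b c * Ff ℓ x d f - Y x b d * Ff ℓ x c f) * n x f))
        + (∑ b, ∑ d, ∑ f, (P x b d * n x f - P x b f * n x d)
            * Y x b d * Uf γ ℓ n n2 x c f)
        + (∑ b, ∑ d, ∑ f, P x b d * n x f
            * (Uf γ ℓ n n2 x b c * Ff ℓ x d f
              - Uf γ ℓ n n2 x b d * Ff ℓ x c f)))) := by
  have hB := fun x (hx : x ∈ U) => symBlocks_of_metricData hdata hx
  have hD : ∀ x ∈ U, InverseDerivs (P x) (Uf γ ℓ n n2 x) (Ff ℓ x) (n x) (fun a => pd a ℓ2 x)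
      (n2 x) (covD2U (Gam0 γ ℓ P n) P x) (covD1U (Gam0 γ ℓ P n) n x) := fun x hx =>
    { Ps := (hB x hx).Ps
      Us := Uf_symm hU hdata hx
      Fa := Ff_antisymm ℓ x
      DP_eq := fun c => (covD_inverse hU hdata hx c).1
      Dn_eq := fun c => (covD_inverse hU hdata hx c).2.1 }
  have dP := fun x (hx : x ∈ U) a b => differentiableAt_of_smooth hU (hdata.2.2.2.1 a b) hx
  have dn := fun x (hx : x ∈ U) a => differentiableAt_of_smooth hU (hdata.2.2.2.2.1 a) hx
  have dn2 := fun x (hx : x ∈ U) => differentiableAt_of_smooth hU hdata.2.2.2.2.2.1 hx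
  have dY := fun x (hx : x ∈ U) a b => differentiableAt_of_smooth hU (hYsm a b) hx
  refine ⟨fun x hx => ?_, fun x hx c => ?_⟩
  · simp only [Idef_eq hU hdata hYsm hYs hx, IIdef_eq hU hdata hYsm hYs hx]
    rw [divergence_vector _ (dP x hx) (dn x hx) (dY x hx)]
    exact normal_transversal_algebra (hD x hx) (hYs x hx) (hB x hx).Pγ' (hB x hx).Pℓ'
  · simp only [Idef_eq hU hdata hYsm hYs hx, IIdef_eq hU hdata hYsm hYs hx]
    rw [divergence_covector (W := fun y b d => n2 y * P y b d - n y b * n y d) _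
      (fun a b => ((dn2 x hx).fun_mul (dP x hx a b)).fun_sub ((dn x hx a).fun_mul (dn x hx b)))
      (dY x hx)]
    exact normal_tangential_algebra (hD x hx) (hYs x hx)
      (fun c => (covD_inverse hU hdata hx c).2.2.1)
      (covD2U_smul_sub_mul _ (dP x hx) (dn x hx) (dn2 x hx)) (hB x hx).γn' (hB x hx).nℓ c

end GaussCodazzi
end
end
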